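/- For every signed permutation matrix χ and all integers k, l ≥ 0, the block diagonal patterns diag(α_k, χ, α_l) and diag(β_k, χ, β_l) are I-Wilf equivalent: for every n ≥ 1, the number of signed involutions in SI_n avoiding diag(α_k, χ, α_l) equals the number avoiding diag(β_k, χ, β_l). -/

import Mathlib

open Matrix

/-- A signed permutation matrix: entries in {0,1,-1}, with exactly one nonzero
entry in each row and each column. -/
def IsSignedPermMatrix {n : ℕ} (M : Matrix (Fin n) (Fin n) ℤ) : Prop :=
  (∀ i j, M i j = 0 ∨ M i j = 1 ∨ M i j = -1) ∧
  (∀ i, ∃! j, M i j ≠ 0) ∧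
  (∀ j, ∃! i, M i j ≠ 0)

/-- `M` contains the pattern `τ`: some `k×k` submatrix of `M`, taken with rows
and columns in increasing order, equals `τ`. -/
def ContainsPattern {n k : ℕ} (M : Matrix (Fin n) (Fin n) ℤ)
    (τ : Matrix (Fin k) (Fin k) ℤ) : Prop :=
  ∃ r c : Fin k → Fin n, StrictMono r ∧ StrictMono c ∧
    ∀ a b, M (r a) (c b) = τ a b

/-- Block diagonal matrix [[A,0],[0,B]]. -/
def blockDiag2 {a b : ℕ} (A : Matrix (Fin a) (Fin a) ℤ) (B : Matrix (Fin b) (Fin b) ℤ) :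
    Matrix (Fin (a + b)) (Fin (a + b)) ℤ :=
  Matrix.reindex finSumFinEquiv finSumFinEquiv
    (Matrix.fromBlocks A (0 : Matrix (Fin a) (Fin b) ℤ) (0 : Matrix (Fin b) (Fin a) ℤ) B)

/-- Block diagonal matrix with three blocks. -/
def blockDiag3 {a b c : ℕ} (A : Matrix (Fin a) (Fin a) ℤ) (B : Matrix (Fin b) (Fin b) ℤ)
    (C : Matrix (Fin c) (Fin c) ℤ) : Matrix (Fin (a + b + c)) (Fin (a + b + c)) ℤ :=
  blockDiag2 (blockDiag2 A B) C

/-- Block antidiagonal matrix [[0,A],[B,0]]. -/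
def antiBlock2 {a b : ℕ} (A : Matrix (Fin a) (Fin a) ℤ) (B : Matrix (Fin b) (Fin b) ℤ) :
    Matrix (Fin (a + b)) (Fin (a + b)) ℤ :=
  Matrix.reindex finSumFinEquiv (finSumFinEquiv.trans (finCongr (Nat.add_comm b a)))
    (Matrix.fromBlocks (0 : Matrix (Fin a) (Fin b) ℤ) A B (0 : Matrix (Fin b) (Fin a) ℤ))

/-- For a signed permutation matrix σ, the involution σ' = [[0,σ],[σᵗ,0]]. -/
def primePat {k : ℕ} (σ : Matrix (Fin k) (Fin k) ℤ) :
    Matrix (Fin (k + k)) (Fin (k + k)) ℤ :=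
  Matrix.reindex finSumFinEquiv finSumFinEquiv
    (Matrix.fromBlocks (0 : Matrix (Fin k) (Fin k) ℤ) σ σ.transpose
      (0 : Matrix (Fin k) (Fin k) ℤ))

/-- For a signed permutation matrix σ, the involution σ'' = [[0,0,σ],[0,1,0],[σᵗ,0,0]]. -/
def doublePrimePat {k : ℕ} (σ : Matrix (Fin k) (Fin k) ℤ) :
    Matrix (Fin (k + (1 + k))) (Fin (k + (1 + k))) ℤ :=
  Matrix.reindex ((Equiv.sumCongr (Equiv.refl (Fin k)) finSumFinEquiv).trans finSumFinEquiv)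
    ((Equiv.sumCongr (Equiv.refl (Fin k)) finSumFinEquiv).trans finSumFinEquiv)
    (Matrix.fromBlocks
      (0 : Matrix (Fin k) (Fin k) ℤ)
      (Matrix.of fun (i : Fin k) (j : Fin 1 ⊕ Fin k) =>
        Sum.elim (fun _ => (0 : ℤ)) (fun j' => σ i j') j)
      (Matrix.of fun (i : Fin 1 ⊕ Fin k) (j : Fin k) =>
        Sum.elim (fun _ => (0 : ℤ)) (fun i' => σ.transpose i' j) i)
      (Matrix.fromBlocks (1 : Matrix (Fin 1) (Fin 1) ℤ) 0 0 (0 : Matrix (Fin k) (Fin k) ℤ)))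

/-- β_k, the antidiagonal k×k permutation matrix (pattern k(k-1)…1). -/
def betaMat (k : ℕ) : Matrix (Fin k) (Fin k) ℤ :=
  Matrix.of fun i j => if (i : ℕ) + (j : ℕ) + 1 = k then 1 else 0

/-- |SI_n(τ)|: the number of τ-avoiding signed involutions of size n. -/
noncomputable def SIAvoidCount (n : ℕ) {k : ℕ} (τ : Matrix (Fin k) (Fin k) ℤ) : ℕ :=
  {M : Matrix (Fin n) (Fin n) ℤ |
    IsSignedPermMatrix M ∧ M.IsSymm ∧ ¬ ContainsPattern M τ}.ncard

/-- |B_n(τ)|: the number of τ-avoiding signed permutations of size n. -/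
noncomputable def BAvoidCount (n : ℕ) {k : ℕ} (τ : Matrix (Fin k) (Fin k) ℤ) : ℕ :=
  {M : Matrix (Fin n) (Fin n) ℤ | IsSignedPermMatrix M ∧ ¬ ContainsPattern M τ}.ncard

/-- `lam` is obtained from `μ` by adding the single cell `s`. -/
def AddCell (μ : YoungDiagram) (s : ℕ × ℕ) (lam : YoungDiagram) : Prop :=
  s ∉ μ ∧ ∀ t, t ∈ lam ↔ t = s ∨ t ∈ μ

/-- A Fomin-type local rule on a unit square with corners `ρ, μ, ν, lam`. -/
inductive LocalRule (next : ℕ × ℕ → ℕ × ℕ → Prop) (init : ℕ × ℕ → Prop) (x : Prop) :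
    YoungDiagram → YoungDiagram → YoungDiagram → YoungDiagram → Prop
  | stay (hx : ¬ x) (ρ) : LocalRule next init x ρ ρ ρ ρ
  | left (hx : ¬ x) {ρ μ s} (h : AddCell ρ s μ) : LocalRule next init x ρ μ ρ μ
  | right (hx : ¬ x) {ρ ν t} (h : AddCell ρ t ν) : LocalRule next init x ρ ρ ν ν
  | join (hx : ¬ x) {ρ μ ν lam s t} (hne : s ≠ t) (h₁ : AddCell ρ s μ) (h₂ : AddCell ρ t ν)
      (h₃ : AddCell μ t lam) (h₄ : AddCell ν s lam) : LocalRule next init x ρ μ ν lam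
  | bump (hx : ¬ x) {ρ μ lam s u} (h₁ : AddCell ρ s μ) (h₂ : AddCell μ u lam) (h : next s u) :
      LocalRule next init x ρ μ μ lam
  | new (hx : x) {ρ lam s} (h : AddCell ρ s lam) (hs : init s) : LocalRule next init x ρ ρ ρ lam

abbrev RowRule (x : Prop) := LocalRule (fun s u => u.1 = s.1 + 1) (fun s => s.1 = 0) x
abbrev ColRule (x : Prop) := LocalRule (fun s u => u.2 = s.2 + 1) (fun s => s.2 = 0) x
abbrev AdjRule := LocalRule
  (fun s u => u = (s.1 + 1, s.2) ∨ u = (s.1, s.2 + 1)) (fun _ => False) False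

namespace AddCell
variable {μ lam lam' : YoungDiagram} {s s' t : ℕ × ℕ}

theorem snd_eq (h : AddCell μ s lam) : s.2 = μ.rowLen s.1 := by
  have h1 : ¬ s.2 < μ.rowLen s.1 := fun hh => h.1 (YoungDiagram.mem_iff_lt_rowLen.2 hh)
  by_contra hne
  have h2 : (s.1, μ.rowLen s.1) ∈ lam :=
    lam.up_left_mem (i2 := s.1) (j2 := s.2) le_rfl (by omega) ((h.2 _).2 (Or.inl rfl))
  rcases (h.2 _).1 h2 with h3 | h3
  · exact hne (congrArg Prod.snd h3).symm
  · exact lt_irrefl _ (YoungDiagram.mem_iff_lt_rowLen.1 h3)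

theorem fst_eq (h : AddCell μ s lam) : s.1 = μ.colLen s.2 := by
  have h1 : ¬ s.1 < μ.colLen s.2 := fun hh => h.1 (YoungDiagram.mem_iff_lt_colLen.2 hh)
  by_contra hne
  have h2 : (μ.colLen s.2, s.2) ∈ lam :=
    lam.up_left_mem (i2 := s.1) (j2 := s.2) (by omega) le_rfl ((h.2 _).2 (Or.inl rfl))
  rcases (h.2 _).1 h2 with h3 | h3
  · exact hne (congrArg Prod.fst h3).symm
  · exact lt_irrefl _ (YoungDiagram.mem_iff_lt_colLen.1 h3)

theorem ext_right (h : AddCell μ s lam) (h' : AddCell μ s lam') : lam = lam' := by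
  apply SetLike.ext; intro t; rw [h.2, h'.2]

theorem ext_left {μ' : YoungDiagram} (h : AddCell μ s lam) (h' : AddCell μ' s lam) : μ = μ' := by
  apply SetLike.ext; intro t
  have := h.2 t; have := h'.2 t; have := h.1; have := h'.1
  grind

theorem eq_of_fst (h : AddCell μ s lam) (h' : AddCell μ s' lam') (e : s.1 = s'.1) : s = s' :=
  Prod.ext e (by rw [h.snd_eq, h'.snd_eq, e])

theorem eq_of_snd (h : AddCell μ s lam) (h' : AddCell μ s' lam') (e : s.2 = s'.2) : s = s' :=
  Prod.ext (by rw [h.fst_eq, h'.fst_eq, e]) e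

theorem cell_unique (h : AddCell μ s lam) (h' : AddCell μ s' lam) : s = s' := by
  have := (h.2 s).1; have := (h'.2 s); have := h.1; have := (h.2 s)
  grind

theorem not_self (h : AddCell μ s μ) : False := h.1 ((h.2 s).2 (Or.inl rfl))

/-- Two distinct cells added to the same diagram can be added together. -/
theorem join (h : AddCell μ s lam) (h' : AddCell μ t lam') (hne : s ≠ t) :
    AddCell lam t (lam ⊔ lam') := by
  refine ⟨fun hh => ?_, fun u => ?_⟩
  · rcases (h.2 _).1 hh with e | e
    · exact hne e.symm
    · exact h'.1 e
  · rw [YoungDiagram.mem_sup, h.2, h'.2]; tauto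

/-- Every cell weakly above-left of an added cell is old or the cell itself. -/
theorem mem_of_le (h : AddCell μ s lam) {a b : ℕ} (ha : a ≤ s.1) (hb : b ≤ s.2)
    (hne : (a, b) ≠ s) : (a, b) ∈ μ := by
  have : (a, b) ∈ lam :=
    lam.up_left_mem (i2 := s.1) (j2 := s.2) ha hb ((h.2 _).2 (Or.inl rfl))
  exact ((h.2 _).1 this).resolve_left hne

theorem snd_succ {ρ : YoungDiagram} (h : AddCell ρ s μ) (h' : AddCell μ t lam)
    (e : t.1 = s.1) : t.2 = s.2 + 1 := by
  have h1 : t.2 ≠ s.2 := fun e' => h'.1 ((h.2 t).2 (Or.inl (Prod.ext e e')))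
  have h2 : ¬ t.2 < s.2 := fun hl =>
    h'.1 ((h.2 t).2 (Or.inr (h.mem_of_le e.le hl.le (fun h3 => h1 (congrArg Prod.snd h3)))))
  by_contra h3
  have h4 := h'.mem_of_le (a := s.1) (b := s.2 + 1) e.ge (by omega)
    (fun h4 => h3 (congrArg Prod.snd h4).symm)
  have h5 := ((h.2 _).1 h4).resolve_left (fun h5 => by simpa using congrArg Prod.snd h5)
  exact h.1 (ρ.up_left_mem (i2 := s.1) (j2 := s.2 + 1) le_rfl (Nat.le_succ _) h5)

theorem fst_succ {ρ : YoungDiagram} (h : AddCell ρ s μ) (h' : AddCell μ t lam)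
    (e : t.2 = s.2) : t.1 = s.1 + 1 := by
  have h1 : t.1 ≠ s.1 := fun e' => h'.1 ((h.2 t).2 (Or.inl (Prod.ext e' e)))
  have h2 : ¬ t.1 < s.1 := fun hl =>
    h'.1 ((h.2 t).2 (Or.inr (h.mem_of_le hl.le e.le (fun h3 => h1 (congrArg Prod.fst h3)))))
  by_contra h3
  have h4 := h'.mem_of_le (a := s.1 + 1) (b := s.2) (by omega) e.ge
    (fun h4 => h3 (congrArg Prod.fst h4).symm)
  have h5 := ((h.2 _).1 h4).resolve_left (fun h5 => by simpa using congrArg Prod.fst h5)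
  exact h.1 (ρ.up_left_mem (i2 := s.1 + 1) (j2 := s.2) (Nat.le_succ _) le_rfl h5)

theorem join_unique_fst {u : ℕ × ℕ} {κ : YoungDiagram} (h : AddCell μ s lam)
    (h' : AddCell μ t lam') (hne : s ≠ t) (hu : AddCell lam u κ) (e : u.1 = t.1) :
    u = t ∧ AddCell lam' s κ := by
  obtain rfl := hu.eq_of_fst (h.join h' hne) e
  obtain rfl := hu.ext_right (h.join h' hne)
  exact ⟨rfl, sup_comm lam lam' ▸ h'.join h hne.symm⟩

theorem below_of_join {u : ℕ × ℕ} {κ κ' : YoungDiagram} (h : AddCell μ s lam)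
    (h' : AddCell μ t lam') (h₁ : AddCell lam t κ) (h₂ : AddCell κ u κ')
    (e : t.2 = s.2 + 1) (e' : u.1 = t.1 + 1) : u.2 = t.2 := by
  have hlt : t.1 < s.1 := by
    by_contra hh
    exact h.1 (h'.mem_of_le (by omega) (by omega) (fun e => by
      have := congrArg Prod.snd e; simp at this; omega))
  by_contra hne
  rcases lt_or_gt_of_ne hne with hl | hl
  · have h3 : (u.1, u.2) ∈ lam := lam.up_left_mem (i2 := s.1) (j2 := s.2) (by omega) (by omega)
      ((h.2 _).2 (Or.inl rfl))
    exact h₂.1 ((h₁.2 _).2 (Or.inr h3))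
  · have h3 := h₂.mem_of_le (a := t.1) (b := t.2 + 1) (by omega) hl
      (fun e => by have := congrArg Prod.fst e; simp at this; omega)
    have h4 := ((h₁.2 _).1 h3).resolve_left (fun h5 => by simpa using congrArg Prod.snd h5)
    exact h₁.1 (lam.up_left_mem (i2 := t.1) (j2 := t.2 + 1) le_rfl (Nat.le_succ _) h4)

theorem snd_le {ρ : YoungDiagram} (h : AddCell ρ s μ) (h' : AddCell μ t lam)
    (e : t.1 = s.1 + 1) : t.2 ≤ s.2 := by
  by_contra h3
  have h4 := h'.mem_of_le (a := s.1) (b := s.2 + 1) (by omega) (by omega)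
    (fun h4 => by have := congrArg Prod.fst h4; simp at this; omega)
  have h5 := ((h.2 _).1 h4).resolve_left (fun h5 => by simpa using congrArg Prod.snd h5)
  exact h.1 (ρ.up_left_mem (i2 := s.1) (j2 := s.2 + 1) le_rfl (Nat.le_succ _) h5)

end AddCell

set_option maxHeartbeats 4000000 in
theorem cube {xa xb : Prop} {ρ μ ν lam ρ' μ' ν' lam' : YoungDiagram}
    (hx : ¬ (xa ∧ xb)) (hA : RowRule xb ρ ρ' ν ν') (hB : RowRule xb μ μ' lam lam')
    (hC : ColRule xa ρ ρ' μ μ') (hN : AdjRule ρ μ ν lam) :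
    ColRule xa ν ν' lam lam' ∧ AdjRule ρ' μ' ν' lam' := by
  cases hN <;> cases hC
  all_goals try first | contradiction | exact (AddCell.not_self ‹_›).elim
  all_goals cases hA
  all_goals try first
    | contradiction
    | exact (AddCell.not_self ‹_›).elim
    | exact absurd ⟨‹_›, ‹_›⟩ hx
  all_goals cases hB
  all_goals try first | contradiction | exact (AddCell.not_self ‹_›).elim
  all_goals try (exfalso; grind only [AddCell.cell_unique, AddCell.not_self, AddCell.eq_of_fst,
    AddCell.eq_of_snd, AddCell.ext_right])
  all_goals try (
    constructor <;> first
    | exact .stay ‹_› _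
    | exact .left ‹_› ‹_›
    | exact .right ‹_› ‹_›
    | exact .new ‹_› ‹_› ‹_›
    | exact .stay not_false _
    | exact .left not_false ‹_›
    | exact .right not_false ‹_›)
  all_goals try (constructor <;> grind only [LocalRule, AddCell.cell_unique, AddCell.eq_of_fst,
    AddCell.eq_of_snd, AddCell.ext_right, AddCell.snd_succ, AddCell.fst_succ,
    AddCell.join_unique_fst, AddCell.below_of_join])
  case left.right.new.new =>
    rename_i hx3 s hs hx2 t ht hx1 p hp0 hp hx0 q hq0 hq
    by_cases hsp : s = p
    · subst hsp
      obtain rfl := hs.ext_right hp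
      exact ⟨.bump ‹_› hs hq (hs.snd_succ hq (by omega)),
        .bump id hs hq (.inr (Prod.ext (by simp; omega) (hs.snd_succ hq (by omega))))⟩
    · obtain ⟨rfl, h⟩ := hs.join_unique_fst hp hsp hq (by omega)
      exact ⟨.join ‹_› (Ne.symm hsp) hp hs h hq, .join id hsp hs hp hq h⟩
  case right.new.right.bump =>
    rename_i hx3 t ht hx2 s hs0 hx1 t' ht' hx0 s' u hu hs hs' hu'
    obtain rfl := hs.cell_unique hs'
    have h := hs.snd_le hu' hu
    exact ⟨.new ‹_› hu' (by omega), .bump id hs hu' (.inl (Prod.ext hu (by simp; omega)))⟩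
  case join.join.bump.bump =>
    rename_i hx3 s t hst hs ht h3 h4 hxa s' t' hne' ht' hxb p u' hu' hp hp' hpu hxb' q u hu h5 h6
      h7 h8
    obtain rfl := ht.cell_unique hp'
    obtain rfl := h3.cell_unique h7
    by_cases hsu : s = u'
    · subst hsu
      obtain rfl := h4.ext_right hpu
      exact ⟨.bump hxa h4 h8 (h4.snd_succ h8 (by omega)),
        .bump id h4 h8 (.inr (Prod.ext (by simp; omega) (h4.snd_succ h8 (by omega))))⟩
    · obtain ⟨rfl, h⟩ := h4.join_unique_fst hpu hsu h8 (by omega)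
      exact ⟨.join hxa (Ne.symm hsu) hpu h4 h h8, .join id hsu h4 hpu h8 h⟩
  case bump.bump.bump.bump =>
    rename_i hx3 s u hu hs hsu hxa s1 u1 hu1 hs1 hxb s2 u2 hu2 hs2 hv hxb' q w hw hq1 hq hw'
    obtain rfl := hs.cell_unique hs1
    obtain rfl := hs.cell_unique hs2
    obtain rfl := hsu.cell_unique hq
    obtain rfl := hsu.cell_unique hq1
    obtain rfl : u = (s.1, s.2 + 1) := by
      rcases hu with h | h
      · rw [h] at hu1; simp at hu1
      · exact h
    have hne : (s.1, s.2 + 1) ≠ u2 := by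
      rintro rfl; simp at hu2
    obtain ⟨rfl, h⟩ := hsu.join_unique_fst hv hne hw' (by simp at hw; omega)
    exact ⟨.join hxa (Ne.symm hne) hv hsu h hw', .join id hne hsu hv hw' h⟩

/-- `μ` is `ρ` or is obtained from `ρ` by adding one cell. -/
def Step (ρ μ : YoungDiagram) : Prop := μ = ρ ∨ ∃ s, AddCell ρ s μ

theorem AddCell.exists_of_mem {μ : YoungDiagram} {s : ℕ × ℕ} (hs : s ∉ μ)
    (h : ∀ a b, a ≤ s.1 → b ≤ s.2 → (a, b) ≠ s → (a, b) ∈ μ) : ∃ lam, AddCell μ s lam := by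
  have hlow : IsLowerSet (↑(insert s μ.cells) : Set (ℕ × ℕ)) := by
    rintro ⟨a, b⟩ ⟨a', b'⟩ hle hm
    simp only [Finset.coe_insert, Set.mem_insert_iff, Finset.mem_coe,
      YoungDiagram.mem_cells] at hm ⊢
    obtain ⟨h1, h2⟩ := Prod.mk_le_mk.1 hle
    by_cases he : (a', b') = s
    · exact Or.inl he
    · right
      rcases hm with rfl | hm
      · exact h _ _ h1 h2 he
      · exact μ.up_left_mem h1 h2 hm
  refine ⟨⟨_, hlow⟩, hs, fun t => ?_⟩
  rw [YoungDiagram.mem_mk, Finset.mem_insert, YoungDiagram.mem_cells]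

theorem AddCell.exists_of_corner {μ : YoungDiagram} {s : ℕ × ℕ} (hs : s ∈ μ)
    (h₁ : (s.1 + 1, s.2) ∉ μ) (h₂ : (s.1, s.2 + 1) ∉ μ) : ∃ ρ, AddCell ρ s μ := by
  have hlow : IsLowerSet (↑(μ.cells.erase s) : Set (ℕ × ℕ)) := by
    rintro ⟨a, b⟩ ⟨a', b'⟩ hle hm
    simp only [Finset.coe_erase, Set.mem_sdiff, Finset.mem_coe, YoungDiagram.mem_cells,
      Set.mem_singleton_iff] at hm ⊢
    obtain ⟨h3, h4⟩ := Prod.mk_le_mk.1 hle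
    refine ⟨μ.up_left_mem h3 h4 hm.1, ?_⟩
    rintro rfl
    rcases h3.lt_or_eq with h5 | rfl
    · exact h₁ (μ.up_left_mem h5 h4 hm.1)
    · rcases h4.lt_or_eq with h5 | rfl
      · exact h₂ (μ.up_left_mem h3 h5 hm.1)
      · exact hm.2 rfl
  refine ⟨⟨_, hlow⟩, ?_, fun t => ?_⟩
  · rw [YoungDiagram.mem_mk]; simp
  · rw [YoungDiagram.mem_mk t (μ.cells.erase s), Finset.mem_erase]
    by_cases h : t = s <;> simp [h, hs]

theorem AddCell.exists_row {μ : YoungDiagram} {r : ℕ} (h : ∀ a < r, (a, μ.rowLen r) ∈ μ) :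
    ∃ s lam, AddCell μ s lam ∧ s.1 = r := by
  obtain ⟨lam, hl⟩ := AddCell.exists_of_mem (μ := μ) (s := (r, μ.rowLen r))
    (by simp [YoungDiagram.mem_iff_lt_rowLen]) (by
      rintro a b ha hb hne
      rcases Nat.lt_or_eq_of_le ha with h1 | rfl
      · exact μ.up_left_mem le_rfl hb (h _ h1)
      · rw [YoungDiagram.mem_iff_lt_rowLen]
        exact lt_of_le_of_ne hb (fun e => hne (Prod.ext rfl e)))
  exact ⟨_, lam, hl, rfl⟩

theorem AddCell.exists_next_row {ρ μ : YoungDiagram} {s : ℕ × ℕ} (h : AddCell ρ s μ) :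
    ∃ u lam, AddCell μ u lam ∧ u.1 = s.1 + 1 := by
  apply AddCell.exists_row
  intro a ha
  have hs : s ∈ μ := (h.2 s).2 (Or.inl rfl)
  refine μ.up_left_mem (i2 := s.1) (j2 := s.2) (by omega) ?_ hs
  by_contra hlt
  have h1 : (s.1 + 1, s.2) ∈ μ := YoungDiagram.mem_iff_lt_rowLen.2 (by omega)
  have h2 := ((h.2 _).1 h1).resolve_left (fun e => by simpa using congrArg Prod.fst e)
  exact h.1 (ρ.up_left_mem (i2 := s.1 + 1) (j2 := s.2) (Nat.le_succ _) le_rfl h2)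

theorem AddCell.exists_prev_row {μ lam : YoungDiagram} {u : ℕ × ℕ} {r : ℕ} (h : AddCell μ u lam)
    (hr : u.1 = r + 1) : ∃ s ρ, AddCell ρ s μ ∧ s.1 = r := by
  have h1 := h.mem_of_le (a := r) (b := u.2) (by omega) le_rfl
    (fun e => by have := congrArg Prod.fst e; simp at this; omega)
  have h2 := h.snd_eq
  rw [YoungDiagram.mem_iff_lt_rowLen] at h1
  rw [hr] at h2
  obtain ⟨ρ, hρ⟩ := AddCell.exists_of_corner (μ := μ) (s := (r, μ.rowLen r - 1))
    (YoungDiagram.mem_iff_lt_rowLen.2 (by omega))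
    (by rw [YoungDiagram.mem_iff_lt_rowLen]; simp only; omega)
    (by rw [YoungDiagram.mem_iff_lt_rowLen]; simp only; omega)
  exact ⟨_, ρ, hρ, rfl⟩

theorem AddCell.rowLen_eq {μ lam : YoungDiagram} {s : ℕ × ℕ} (h : AddCell μ s lam) (a : ℕ) :
    lam.rowLen a = if a = s.1 then μ.rowLen a + 1 else μ.rowLen a := by
  apply eq_of_forall_lt_iff
  intro b
  rw [← YoungDiagram.mem_iff_lt_rowLen, h.2]
  have h1 := h.snd_eq
  split_ifs with ha
  · subst ha
    rw [YoungDiagram.mem_iff_lt_rowLen, Prod.ext_iff]; simp only [true_and]; omega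
  · rw [YoungDiagram.mem_iff_lt_rowLen, Prod.ext_iff]; simp [ha]

theorem AddCell.colLen_eq {μ lam : YoungDiagram} {s : ℕ × ℕ} (h : AddCell μ s lam) (b : ℕ) :
    lam.colLen b = if b = s.2 then μ.colLen b + 1 else μ.colLen b := by
  apply eq_of_forall_lt_iff
  intro a
  rw [← YoungDiagram.mem_iff_lt_colLen, h.2]
  have h1 := h.fst_eq
  split_ifs with ha
  · subst ha
    rw [YoungDiagram.mem_iff_lt_colLen, Prod.ext_iff]; simp only [and_true]; omega
  · rw [YoungDiagram.mem_iff_lt_colLen, Prod.ext_iff]; simp [ha]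

theorem AddCell.transpose {μ lam : YoungDiagram} {s : ℕ × ℕ} (h : AddCell μ s lam) :
    AddCell μ.transpose s.swap lam.transpose := by
  refine ⟨by simpa using h.1, fun t => ?_⟩
  rw [YoungDiagram.mem_transpose, YoungDiagram.mem_transpose, h.2, Prod.swap_eq_iff_eq_swap]

theorem Step.transpose {ρ μ : YoungDiagram} (h : Step ρ μ) : Step ρ.transpose μ.transpose := by
  rcases h with rfl | ⟨s, h⟩
  · exact Or.inl rfl
  · exact Or.inr ⟨_, h.transpose⟩

theorem Step.eq_bot {ρ : YoungDiagram} (h : Step ρ ⊥) : ρ = ⊥ := by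
  rcases h with h | ⟨s, h⟩
  · exact h.symm
  · exact absurd ((h.2 s).2 (Or.inl rfl)) (YoungDiagram.notMem_bot s)

namespace LocalRule
variable {next : ℕ × ℕ → ℕ × ℕ → Prop} {init : ℕ × ℕ → Prop} {x x' : Prop}
  {ρ ρ' μ ν lam lam' : YoungDiagram}

theorem symm (h : LocalRule next init x ρ μ ν lam) : LocalRule next init x ρ ν μ lam := by
  cases h with
  | stay hx ρ => exact .stay hx ρ
  | left hx h => exact .right hx h
  | right hx h => exact .left hx h
  | join hx hne h₁ h₂ h₃ h₄ => exact .join hx hne.symm h₂ h₁ h₄ h₃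
  | bump hx h₁ h₂ h => exact .bump hx h₁ h₂ h
  | new hx h hs => exact .new hx h hs

theorem step_left (h : LocalRule next init x ρ μ ν lam) : Step ρ μ ∧ Step ν lam := by
  cases h with
  | stay hx ρ => exact ⟨.inl rfl, .inl rfl⟩
  | left hx h => exact ⟨.inr ⟨_, h⟩, .inr ⟨_, h⟩⟩
  | right hx h => exact ⟨.inl rfl, .inl rfl⟩
  | join hx hne h₁ h₂ h₃ h₄ => exact ⟨.inr ⟨_, h₁⟩, .inr ⟨_, h₄⟩⟩
  | bump hx h₁ h₂ h => exact ⟨.inr ⟨_, h₁⟩, .inr ⟨_, h₂⟩⟩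
  | new hx h hs => exact ⟨.inl rfl, .inr ⟨_, h⟩⟩

theorem step_right (h : LocalRule next init x ρ μ ν lam) : Step ρ ν ∧ Step μ lam :=
  h.symm.step_left

theorem eq_of_mark (h : LocalRule next init x ρ μ ν lam) (hx : x) : μ = ρ ∧ ν = ρ ∧ lam ≠ ρ := by
  cases h with
  | new _ h => exact ⟨rfl, rfl, fun e => (e ▸ h).not_self⟩
  | _ => contradiction

theorem eq_iff (h : LocalRule next init x ρ μ ν lam) : lam = ν ↔ ¬ x ∧ μ = ρ := by
  cases h with
  | stay hx ρ => simp [hx]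
  | left hx h => exact ⟨fun e => (e ▸ h).not_self.elim, fun e => e.2⟩
  | right hx h => simp [hx]
  | join hx hne h₁ h₂ h₃ h₄ =>
    exact ⟨fun e => (e ▸ h₄).not_self.elim, fun e => (e.2 ▸ h₁).not_self.elim⟩
  | bump hx h₁ h₂ h =>
    exact ⟨fun e => (e ▸ h₂).not_self.elim, fun e => (e.2 ▸ h₁).not_self.elim⟩
  | new hx h hs => exact ⟨fun e => (e ▸ h).not_self.elim, fun e => (e.1 hx).elim⟩

end LocalRule

namespace RowRule
variable {x x' : Prop} {ρ ρ' μ ν lam lam' : YoungDiagram}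

theorem unique (h : RowRule x ρ μ ν lam) (h' : RowRule x ρ μ ν lam') : lam = lam' := by
  cases h <;> cases h' <;> first
    | contradiction
    | rfl
    | exact (AddCell.not_self ‹_›).elim
    | grind only [AddCell.cell_unique, AddCell.not_self, AddCell.eq_of_fst, AddCell.ext_right]

theorem inv_unique (h : RowRule x ρ μ ν lam) (h' : RowRule x' ρ' μ ν lam) :
    ρ = ρ' ∧ (x ↔ x') := by
  have key {s s' : ℕ × ℕ} {κ κ' : YoungDiagram} (h : AddCell κ s μ) (h' : AddCell κ' s' μ)
      (e : s.1 = s'.1) : κ = κ' := by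
    have h1 := h.rowLen_eq s.1
    have h2 := h'.rowLen_eq s.1
    have h3 := h.snd_eq
    have h4 := h'.snd_eq
    rw [← e] at h2 h4
    simp only [if_true] at h1 h2
    obtain rfl : s = s' := Prod.ext e (by omega)
    exact h.ext_left h'
  cases h <;> cases h' <;> first
    | exact (AddCell.not_self ‹_›).elim
    | exact ⟨rfl, by simp [*]⟩
    | grind only [AddCell.cell_unique, AddCell.not_self, AddCell.ext_left]

theorem exists_right (h₁ : Step ρ μ) (h₂ : Step ρ ν) (hx : x → μ = ρ ∧ ν = ρ) :
    ∃ lam, RowRule x ρ μ ν lam := by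
  by_cases h : x
  · obtain ⟨e₁, e₂⟩ := hx h
    subst e₁ e₂
    obtain ⟨s, lam, hs, h0⟩ := AddCell.exists_row (r := 0) (by simp)
    exact ⟨lam, .new h hs h0⟩
  rcases h₁ with rfl | ⟨s, hs⟩
  · rcases h₂ with rfl | ⟨t, ht⟩
    · exact ⟨_, .stay h _⟩
    · exact ⟨_, .right h ht⟩
  · rcases h₂ with rfl | ⟨t, ht⟩
    · exact ⟨_, .left h hs⟩
    · by_cases e : s = t
      · subst e
        obtain rfl := hs.ext_right ht
        obtain ⟨u, lam, hu, h1⟩ := hs.exists_next_row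
        exact ⟨lam, .bump h hs hu h1⟩
      · exact ⟨μ ⊔ ν, .join h e hs ht (hs.join ht e) (sup_comm μ ν ▸ ht.join hs (Ne.symm e))⟩

theorem exists_left (h₁ : Step μ lam) (h₂ : Step ν lam) : ∃ ρ x, RowRule x ρ μ ν lam := by
  rcases h₁ with rfl | ⟨t, ht⟩
  · rcases h₂ with rfl | ⟨s, hs⟩
    · exact ⟨_, False, .stay id _⟩
    · exact ⟨_, False, .left id hs⟩
  · rcases h₂ with rfl | ⟨s, hs⟩
    · exact ⟨_, False, .right id ht⟩
    · by_cases e : t = s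
      · subst e
        obtain rfl := ht.ext_left hs
        rcases h : t.1 with _ | r
        · exact ⟨_, True, .new trivial ht h⟩
        · obtain ⟨s, ρ, hs, rfl⟩ := ht.exists_prev_row h
          exact ⟨ρ, False, .bump id hs ht h⟩
      · have hsm : s ∈ μ := ((ht.2 s).1 ((hs.2 s).2 (Or.inl rfl))).resolve_left (Ne.symm e)
        have htn : t ∈ ν := ((hs.2 t).1 ((ht.2 t).2 (Or.inl rfl))).resolve_left e
        refine ⟨μ ⊓ ν, False, .join (s := s) (t := t) id (Ne.symm e) ⟨?_, fun u => ?_⟩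
          ⟨?_, fun u => ?_⟩ ht hs⟩
        · rw [YoungDiagram.mem_inf]; exact fun hh => hs.1 hh.2
        · rw [YoungDiagram.mem_inf]
          have := ht.2 u; have := hs.2 u; have := ht.1
          grind
        · rw [YoungDiagram.mem_inf]; exact fun hh => ht.1 hh.1
        · rw [YoungDiagram.mem_inf]
          have := ht.2 u; have := hs.2 u; have := hs.1
          grind

theorem rowLen_zero (h : RowRule x ρ μ ν lam) :
    (x → lam.rowLen 0 = ρ.rowLen 0 + 1) ∧
      (¬ x → lam.rowLen 0 = max (μ.rowLen 0) (ν.rowLen 0)) := by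
  cases h with
  | stay hx ρ => simp [hx]
  | left hx h => have := h.rowLen_eq 0; grind
  | right hx h => have := h.rowLen_eq 0; grind
  | join hx hne h₁ h₂ h₃ h₄ =>
    have := h₁.rowLen_eq 0; have := h₂.rowLen_eq 0; have := h₃.rowLen_eq 0
    have := fun e => hne (h₁.eq_of_fst h₂ e)
    grind
  | bump hx h₁ h₂ h => have := h₂.rowLen_eq 0; grind
  | new hx h hs => have := h.rowLen_eq 0; grind

end RowRule

theorem ColRule.colLen_zero {x : Prop} {ρ μ ν lam : YoungDiagram} (h : ColRule x ρ μ ν lam) :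
    (x → lam.colLen 0 = ρ.colLen 0 + 1) ∧
      (¬ x → lam.colLen 0 = max (μ.colLen 0) (ν.colLen 0)) := by
  cases h with
  | stay hx ρ => simp [hx]
  | left hx h => have := h.colLen_eq 0; grind
  | right hx h => have := h.colLen_eq 0; grind
  | join hx hne h₁ h₂ h₃ h₄ =>
    have := h₁.colLen_eq 0; have := h₂.colLen_eq 0; have := h₃.colLen_eq 0
    have := fun e => hne (h₁.eq_of_snd h₂ e)
    grind
  | bump hx h₁ h₂ h => have := h₂.colLen_eq 0; grind
  | new hx h hs => have := h.colLen_eq 0; grind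

/-- `F` marks at most one cell in every row and column. -/
def IsPartialPerm (F : ℕ → ℕ → Prop) : Prop :=
  (∀ i j j', F i j → F i j' → j = j') ∧ ∀ i₁ i₂ j, F i₁ j → F i₂ j → i₁ = i₂

/-- `g` labels the vertices of the grid by the growth diagram of `F` on the cells of `G`. -/
structure GrowthOn (G : Set (ℕ × ℕ)) (F : ℕ → ℕ → Prop) (g : ℕ → ℕ → YoungDiagram) : Prop where
  row_zero : ∀ j, g 0 j = ⊥
  col_zero : ∀ i, g i 0 = ⊥
  rule : ∀ i j, (i, j) ∈ G → RowRule (F i j) (g i j) (g (i + 1) j) (g i (j + 1)) (g (i + 1) (j + 1))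

theorem IsPartialPerm.swap {F : ℕ → ℕ → Prop} (h : IsPartialPerm F) :
    IsPartialPerm fun i j => F j i :=
  ⟨fun i j j' => h.2 j j' i, fun i i' j => h.1 j i i'⟩

theorem IsPartialPerm.mono {F F' : ℕ → ℕ → Prop} (h : IsPartialPerm F)
    (hF : ∀ i j, F' i j → F i j) : IsPartialPerm F' :=
  ⟨fun i j j' a b => h.1 i j j' (hF _ _ a) (hF _ _ b),
    fun i i' j a b => h.2 i i' j (hF _ _ a) (hF _ _ b)⟩

namespace GrowthOn
variable {G G' : Set (ℕ × ℕ)} {F F' : ℕ → ℕ → Prop} {g g' : ℕ → ℕ → YoungDiagram}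

theorem mono (h : GrowthOn G F g) (hG : G' ⊆ G) : GrowthOn G' F g :=
  ⟨h.row_zero, h.col_zero, fun i j hij => h.rule i j (hG hij)⟩

theorem swap (h : GrowthOn G F g) :
    GrowthOn (Prod.swap ⁻¹' G) (fun i j => F j i) (fun i j => g j i) :=
  ⟨h.col_zero, h.row_zero, fun i j hij => (h.rule j i hij).symm⟩

theorem step_row (h : GrowthOn G F g) {i j : ℕ} (hG : ∀ b < j, (i, b) ∈ G) :
    Step (g i j) (g (i + 1) j) := by
  cases j with
  | zero => rw [h.col_zero, h.col_zero]; exact Or.inl rfl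
  | succ j => exact (h.rule i j (hG j (Nat.lt_succ_self j))).step_left.2

theorem row_eq_iff (h : GrowthOn G F g) {i j : ℕ} (hG : ∀ b < j, (i, b) ∈ G) :
    g (i + 1) j = g i j ↔ ∀ b < j, ¬ F i b := by
  induction j with
  | zero => simp [h.col_zero]
  | succ j ih =>
    rw [(h.rule i j (hG j (Nat.lt_succ_self j))).eq_iff, ih fun b hb => hG b (by omega),
      Nat.forall_lt_succ_right, and_comm]

theorem step_col (h : GrowthOn G F g) {i j : ℕ} (hG : ∀ a < i, (a, j) ∈ G) :
    Step (g i j) (g i (j + 1)) :=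
  h.swap.step_row (i := j) (j := i) hG

theorem col_eq_iff (h : GrowthOn G F g) {i j : ℕ} (hG : ∀ a < i, (a, j) ∈ G) :
    g i (j + 1) = g i j ↔ ∀ a < i, ¬ F a j :=
  h.swap.row_eq_iff (i := j) (j := i) hG

theorem unique (h : GrowthOn G F g) (h' : GrowthOn G F g') {i j : ℕ}
    (hij : ∀ a b, a < i → b < j → (a, b) ∈ G) : g i j = g' i j := by
  induction i generalizing j with
  | zero => rw [h.row_zero, h'.row_zero]
  | succ i ihi =>
    induction j with
    | zero => rw [h.col_zero, h'.col_zero]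
    | succ j ihj =>
      have hr := h.rule i j (hij i j (by omega) (by omega))
      have hrule := h'.rule i j (hij i j (by omega) (by omega))
      rw [← ihi fun a b ha hb => hij a b (by omega) (by omega),
        ← ihi fun a b ha hb => hij a b (by omega) (by omega),
        ← ihj fun a b ha hb => hij a b (by omega) (by omega)] at hrule
      exact hr.unique hrule

/-- A growth diagram is determined by its labels along the outer border. -/
theorem eq_of_border (G : Finset (ℕ × ℕ)) (hG : IsLowerSet (G : Set (ℕ × ℕ)))
    (h : GrowthOn G F g) (h' : GrowthOn G F' g')
    (hb : ∀ a b, (a, b) ∈ G → (a + 1, b + 1) ∉ G → g (a + 1) (b + 1) = g' (a + 1) (b + 1))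
    {a b : ℕ} (hab : (a, b) ∈ G) : g a b = g' a b ∧ (F a b ↔ F' a b) := by
  have key : ∀ n a b, (a, b) ∈ G → G.sup (fun p => p.1 + p.2) < a + b + n →
      g (a + 1) (b + 1) = g' (a + 1) (b + 1) := by
    intro n
    induction n with
    | zero =>
      intro a b hab hn
      exact absurd (Finset.le_sup (f := fun p : ℕ × ℕ => p.1 + p.2) hab) (by simpa using hn)
    | succ n ih =>
      intro a b hab hn
      by_cases hd : (a + 1, b + 1) ∈ G
      · have h1 : (a + 1, b) ∈ G := hG (Prod.mk_le_mk.2 ⟨le_rfl, by omega⟩) hd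
        have h2 : (a, b + 1) ∈ G := hG (Prod.mk_le_mk.2 ⟨by omega, le_rfl⟩) hd
        have hr := h.rule _ _ hd
        have hr' := h'.rule _ _ hd
        rw [← ih _ _ hd (by omega), ← ih _ _ h1 (by omega), ← ih _ _ h2 (by omega)] at hr'
        exact (RowRule.inv_unique hr hr').1
      · exact hb a b hab hd
  have key' : ∀ a b, (a, b) ∈ G → g (a + 1) (b + 1) = g' (a + 1) (b + 1) := fun a b hab =>
    key (G.sup (fun p => p.1 + p.2) + 1) a b hab (by omega)
  have hr := h.rule _ _ hab
  have hr' := h'.rule _ _ hab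
  have e1 : g (a + 1) b = g' (a + 1) b := by
    cases b with
    | zero => rw [h.col_zero, h'.col_zero]
    | succ b => exact key' a b (hG (Prod.mk_le_mk.2 ⟨le_rfl, by omega⟩) hab)
  have e2 : g a (b + 1) = g' a (b + 1) := by
    cases a with
    | zero => rw [h.row_zero, h'.row_zero]
    | succ a => exact key' a b (hG (Prod.mk_le_mk.2 ⟨by omega, le_rfl⟩) hab)
  rw [← key' a b hab, ← e1, ← e2] at hr'
  exact RowRule.inv_unique hr hr'

end GrowthOn

open Classical in
/-- The labels of the growth diagram of `F` on the full quadrant. -/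
noncomputable def growth (F : ℕ → ℕ → Prop) : ℕ → ℕ → YoungDiagram
  | 0, _ => ⊥
  | _ + 1, 0 => ⊥
  | i + 1, j + 1 =>
    if h : ∃ lam, RowRule (F i j) (growth F i j) (growth F (i + 1) j) (growth F i (j + 1)) lam
    then h.choose else ⊥

theorem growthOn_growth {F : ℕ → ℕ → Prop} (hF : IsPartialPerm F) :
    GrowthOn Set.univ F (growth F) := by
  have h0 : ∀ j, growth F 0 j = ⊥ := fun j => by rw [growth]
  have h0' : ∀ i, growth F i 0 = ⊥ := fun i => by cases i <;> rw [growth]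
  have hrule : ∀ i j, (∃ lam, RowRule (F i j) (growth F i j) (growth F (i + 1) j)
      (growth F i (j + 1)) lam) → RowRule (F i j) (growth F i j) (growth F (i + 1) j)
      (growth F i (j + 1)) (growth F (i + 1) (j + 1)) := by
    intro i j h
    have e : growth F (i + 1) (j + 1) = h.choose := by rw [growth, dif_pos h]
    rw [e]; exact h.choose_spec
  have key : ∀ n i j, i + j = n →
      (Step (growth F i j) (growth F (i + 1) j) ∧
        ((∀ b < j, ¬ F i b) → growth F (i + 1) j = growth F i j)) ∧
      (Step (growth F i j) (growth F i (j + 1)) ∧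
        ((∀ a < i, ¬ F a j) → growth F i (j + 1) = growth F i j)) := by
    intro n
    induction n with
    | zero =>
      intro i j hij
      obtain ⟨rfl, rfl⟩ : i = 0 ∧ j = 0 := by omega
      simp [h0, h0', Step]
    | succ n ih =>
      have hr : ∀ i j, i + j = n → RowRule (F i j) (growth F i j) (growth F (i + 1) j)
          (growth F i (j + 1)) (growth F (i + 1) (j + 1)) := by
        intro i j hij
        obtain ⟨⟨a1, a2⟩, b1, b2⟩ := ih i j hij
        refine hrule i j (RowRule.exists_right a1 b1 fun hx => ⟨a2 ?_, b2 ?_⟩)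
        · intro b hb h; exact hb.ne (hF.1 _ _ _ h hx)
        · intro a ha h; exact ha.ne (hF.2 _ _ _ h hx)
      intro i j hij
      constructor
      · cases j with
        | zero => simp [h0', Step]
        | succ j =>
          refine ⟨(hr i j (by omega)).step_left.2, fun h => ?_⟩
          rw [(hr i j (by omega)).eq_iff]
          exact ⟨h j (by omega), (ih i j (by omega)).1.2 fun b hb => h b (by omega)⟩
      · cases i with
        | zero => simp [h0, Step]
        | succ i =>
          refine ⟨(hr i j (by omega)).step_right.2, fun h => ?_⟩
          rw [(hr i j (by omega)).symm.eq_iff]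
          exact ⟨h i (by omega), (ih i j (by omega)).2.2 fun b hb => h b (by omega)⟩
  refine ⟨h0, h0', fun i j _ => hrule i j ?_⟩
  obtain ⟨⟨a1, a2⟩, b1, b2⟩ := key _ i j rfl
  refine RowRule.exists_right a1 b1 fun hx => ⟨a2 ?_, b2 ?_⟩
  · intro b hb h; exact hb.ne (hF.1 _ _ _ h hx)
  · intro a ha h; exact ha.ne (hF.2 _ _ _ h hx)

/-- Every admissible labelling of the border of `G` comes from a growth diagram. -/
theorem exists_growthOn (G : Finset (ℕ × ℕ)) (hG : IsLowerSet (G : Set (ℕ × ℕ)))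
    (L : ℕ → ℕ → YoungDiagram) (h0 : ∀ j, L 0 j = ⊥) (h0' : ∀ i, L i 0 = ⊥)
    (h₁ : ∀ i j, (i, j) ∈ G → (i, j + 1) ∉ G → Step (L i (j + 1)) (L (i + 1) (j + 1)))
    (h₂ : ∀ i j, (i, j) ∈ G → (i + 1, j) ∉ G → Step (L (i + 1) j) (L (i + 1) (j + 1))) :
    ∃ F g, IsPartialPerm F ∧ (∀ i j, F i j → (i, j) ∈ G) ∧ GrowthOn G F g ∧
      ∀ i j, (i, j) ∉ G → g i j = L i j := by
  classical
  induction hn : G.card generalizing G L with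
  | zero =>
    obtain rfl := Finset.card_eq_zero.1 hn
    exact ⟨fun _ _ => False, L, ⟨fun _ _ _ h => h.elim, fun _ _ _ h => h.elim⟩,
      fun _ _ h => h.elim, ⟨h0, h0', fun i j h => by simp at h⟩, fun _ _ _ => rfl⟩
  | succ n ih =>
    obtain ⟨⟨i, j⟩, hmax⟩ := G.exists_maximal (Finset.card_pos.1 (by omega))
    have hc : (i, j) ∈ G := hmax.prop
    have hr : (i + 1, j) ∉ G := fun h => by
      have := hmax.le_of_ge h (Prod.mk_le_mk.2 ⟨by omega, le_rfl⟩)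
      simp [Prod.mk_le_mk] at this
    have hd : (i, j + 1) ∉ G := fun h => by
      have := hmax.le_of_ge h (Prod.mk_le_mk.2 ⟨le_rfl, by omega⟩)
      simp [Prod.mk_le_mk] at this
    obtain ⟨ρ, x, hx⟩ := RowRule.exists_left (h₂ i j hc hr) (h₁ i j hc hd)
    have hρi : i = 0 → ρ = ⊥ := by
      rintro rfl
      exact Step.eq_bot (h0 (j + 1) ▸ hx.step_right.1)
    have hρj : j = 0 → ρ = ⊥ := by
      rintro rfl
      exact Step.eq_bot (h0' (i + 1) ▸ hx.step_left.1)
    have hL : ∀ a b, (a, b) ≠ (i, j) → (if (a, b) = (i, j) then ρ else L a b) = L a b :=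
      fun a b h => if_neg h
    obtain ⟨F, g, hF, hFG, hg, hgL⟩ := ih (G.erase (i, j))
      (by
        rintro ⟨a, b⟩ ⟨a', b'⟩ hle hm
        simp only [Finset.coe_erase, Set.mem_sdiff, Finset.mem_coe, Set.mem_singleton_iff] at hm ⊢
        refine ⟨hG hle hm.1, ?_⟩
        rintro ⟨rfl, rfl⟩
        exact hm.2 (le_antisymm (hmax.le_of_ge hm.1 hle) hle))
      (fun a b => if (a, b) = (i, j) then ρ else L a b)
      (fun b => by grind) (fun a => by grind)
      (fun a b hab hab' => by
        rw [Finset.mem_erase] at hab hab'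
        have e : (a + 1, b + 1) ≠ (i, j) := by
          rintro e
          obtain ⟨rfl, rfl⟩ := Prod.ext_iff.1 e
          exact hab' ⟨by simp, hG (Prod.mk_le_mk.2 ⟨by omega, le_rfl⟩) hc⟩
        simp only [hL _ _ e]
        by_cases e' : (a, b + 1) = (i, j)
        · obtain ⟨rfl, rfl⟩ := Prod.ext_iff.1 e'
          simpa using hx.step_left.1
        · simp only [hL _ _ e']
          exact h₁ a b hab.2 fun h => hab' ⟨e', h⟩)
      (fun a b hab hab' => by
        rw [Finset.mem_erase] at hab hab'
        have e : (a + 1, b + 1) ≠ (i, j) := by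
          rintro e
          obtain ⟨rfl, rfl⟩ := Prod.ext_iff.1 e
          exact hab' ⟨by simp, hG (Prod.mk_le_mk.2 ⟨le_rfl, by omega⟩) hc⟩
        simp only [hL _ _ e]
        by_cases e' : (a + 1, b) = (i, j)
        · obtain ⟨rfl, rfl⟩ := Prod.ext_iff.1 e'
          simpa using hx.step_right.1
        · simp only [hL _ _ e']
          exact h₂ a b hab.2 fun h => hab' ⟨e', h⟩)
      (by rw [Finset.card_erase_of_mem hc]; omega)
    have hval : ∀ a b, (a, b) ∉ G → g a b = L a b := fun a b h => by
      rw [hgL a b fun h' => h (Finset.mem_of_mem_erase h')]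
      exact hL a b (by rintro e; exact h (e ▸ hc))
    have hgρ : g i j = ρ := by rw [hgL i j (by simp)]; simp
    have hrd : (i + 1, j + 1) ∉ G := fun h => hr (hG (Prod.mk_le_mk.2 ⟨le_rfl, by omega⟩) h)
    rw [← hgρ, ← hval _ _ hr, ← hval _ _ hd, ← hval _ _ hrd] at hx
    have hrow : x → ∀ b, ¬ F i b := by
      intro hx' b hb
      have h1 := (hg.row_eq_iff (i := i) (j := j) (fun b hb => by
        have := hG (a := (i, j)) (b := (i, b)) (Prod.mk_le_mk.2 ⟨le_rfl, hb.le⟩) hc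
        simpa [hb.ne] using this)).1 (hx.eq_of_mark hx').1
      rcases lt_or_ge b j with h2 | h2
      · exact h1 b h2 hb
      · have h3 := Finset.mem_erase.1 (hFG _ _ hb)
        have := hmax.le_of_ge h3.2 (Prod.mk_le_mk.2 ⟨le_rfl, h2⟩)
        exact h3.1 (by have := (Prod.mk_le_mk.1 this).2; simp; omega)
    have hcol : x → ∀ a, ¬ F a j := by
      intro hx' a ha
      have h1 := (hg.col_eq_iff (i := i) (j := j) (fun b hb => by
        have := hG (a := (i, j)) (b := (b, j)) (Prod.mk_le_mk.2 ⟨hb.le, le_rfl⟩) hc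
        simpa [hb.ne] using this)).1 (hx.eq_of_mark hx').2.1
      rcases lt_or_ge a i with h2 | h2
      · exact h1 a h2 ha
      · have h3 := Finset.mem_erase.1 (hFG _ _ ha)
        have := hmax.le_of_ge h3.2 (Prod.mk_le_mk.2 ⟨h2, le_rfl⟩)
        exact h3.1 (by have := (Prod.mk_le_mk.1 this).1; simp; omega)
    refine ⟨fun a b => F a b ∨ (x ∧ a = i ∧ b = j), g, ⟨?_, ?_⟩, ?_, ⟨hg.row_zero, hg.col_zero, ?_⟩,
      hval⟩
    · rintro a b b' (h | ⟨hx', rfl, rfl⟩) (h' | ⟨hx'', e, rfl⟩)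
      · exact hF.1 _ _ _ h h'
      · exact absurd h (e ▸ hrow hx'' b)
      · exact absurd h' (hrow hx' b')
      · rfl
    · rintro a b b' (h | ⟨hx', rfl, rfl⟩) (h' | ⟨hx'', rfl, e⟩)
      · exact hF.2 _ _ _ h h'
      · exact absurd h (e ▸ hcol hx'' a)
      · exact absurd h' (hcol hx' b)
      · rfl
    · rintro a b (h | ⟨_, rfl, rfl⟩)
      · exact Finset.mem_of_mem_erase (hFG _ _ h)
      · exact hc
    · intro a b hab
      by_cases e : (a, b) = (i, j)
      · obtain ⟨rfl, rfl⟩ := Prod.ext_iff.1 e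
        have : ¬ F a b := fun h => by simpa using hFG _ _ h
        simp only [this, and_true, false_or]
        exact hx
      · have : (F a b ∨ x ∧ a = i ∧ b = j) ↔ F a b := by
          have : ¬ (a = i ∧ b = j) := fun h => e (Prod.ext h.1 h.2)
          tauto
        simp only [this]
        exact hg.rule a b (Finset.mem_erase.2 ⟨e, hab⟩)

/-- An increasing chain of `k` marks of `F` in the first `i` rows and `j` columns. -/
def IncChain (F : ℕ → ℕ → Prop) (i j k : ℕ) : Prop :=
  ∃ r c : Fin k → ℕ, StrictMono r ∧ StrictMono c ∧ ∀ t, F (r t) (c t) ∧ r t < i ∧ c t < j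

/-- A decreasing chain of `k` marks of `F` in the first `i` rows and `j` columns. -/
def DecChain (F : ℕ → ℕ → Prop) (i j k : ℕ) : Prop :=
  ∃ r c : Fin k → ℕ, StrictMono r ∧ StrictAnti c ∧ ∀ t, F (r t) (c t) ∧ r t < i ∧ c t < j

theorem IncChain.mono {F F' : ℕ → ℕ → Prop} {i j i' j' k : ℕ} (h : IncChain F i j k)
    (hi : i ≤ i') (hj : j ≤ j') (hF : ∀ a b, a < i → b < j → F a b → F' a b) :
    IncChain F' i' j' k := by
  obtain ⟨r, c, hr, hc, h⟩ := h
  exact ⟨r, c, hr, hc, fun t => ⟨hF _ _ (h t).2.1 (h t).2.2 (h t).1, (h t).2.1.trans_le hi,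
    (h t).2.2.trans_le hj⟩⟩

theorem DecChain.mono {F F' : ℕ → ℕ → Prop} {i j i' j' k : ℕ} (h : DecChain F i j k)
    (hi : i ≤ i') (hj : j ≤ j') (hF : ∀ a b, a < i → b < j → F a b → F' a b) :
    DecChain F' i' j' k := by
  obtain ⟨r, c, hr, hc, h⟩ := h
  exact ⟨r, c, hr, hc, fun t => ⟨hF _ _ (h t).2.1 (h t).2.2 (h t).1, (h t).2.1.trans_le hi,
    (h t).2.2.trans_le hj⟩⟩

theorem incChain_succ_iff {F : ℕ → ℕ → Prop} {i j k : ℕ} :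
    IncChain F i j (k + 1) ↔ ∃ a b, F a b ∧ a < i ∧ b < j ∧ IncChain F a b k := by
  constructor
  · rintro ⟨r, c, hr, hc, h⟩
    exact ⟨r (Fin.last k), c (Fin.last k), (h _).1, (h _).2.1, (h _).2.2, r ∘ Fin.castSucc,
      c ∘ Fin.castSucc, hr.comp Fin.strictMono_castSucc, hc.comp Fin.strictMono_castSucc,
      fun t => ⟨(h _).1, hr (Fin.castSucc_lt_last t), hc (Fin.castSucc_lt_last t)⟩⟩
  · rintro ⟨a, b, hab, ha, hb, r, c, hr, hc, h⟩
    have key : ∀ (r : Fin k → ℕ) a, StrictMono r → (∀ t, r t < a) →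
        StrictMono (Fin.snoc (α := fun _ => ℕ) r a) := by
      intro r a hr h s t hst
      induction t using Fin.lastCases with
      | last =>
        induction s using Fin.lastCases with
        | last => exact absurd hst (lt_irrefl _)
        | cast s => simpa using h s
      | cast t =>
        induction s using Fin.lastCases with
        | last => exact absurd (hst.trans (Fin.castSucc_lt_last t)) (lt_irrefl _)
        | cast s => simpa using hr (Fin.castSucc_lt_castSucc_iff.1 hst)
    refine ⟨_, _, key r a hr fun t => (h t).2.1, key c b hc fun t => (h t).2.2, fun t => ?_⟩
    induction t using Fin.lastCases with
    | last => simpa using ⟨hab, ha, hb⟩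
    | cast t => simpa using ⟨(h t).1, (h t).2.1.trans ha, (h t).2.2.trans hb⟩

theorem incChain_zero (F : ℕ → ℕ → Prop) (i j : ℕ) : IncChain F i j 0 :=
  ⟨Fin.elim0, Fin.elim0, fun t => t.elim0, fun t => t.elim0, fun t => t.elim0⟩

/-- The longest-chain recursion computes the maximal length of an increasing chain. -/
theorem le_iff_incChain {F : ℕ → ℕ → Prop} {h : ℕ → ℕ → ℕ} {J : ℕ} (h0 : ∀ j, h 0 j = 0)
    (h0' : ∀ i, h i 0 = 0)
    (hF : ∀ i j, j < J → (F i j → h (i + 1) (j + 1) = h i j + 1) ∧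
      (¬ F i j → h (i + 1) (j + 1) = max (h (i + 1) j) (h i (j + 1))))
    {i j k : ℕ} (hj : j ≤ J) : k ≤ h i j ↔ IncChain F i j k := by
  induction i generalizing j k with
  | zero =>
    cases k with
    | zero => simp [incChain_zero]
    | succ k => simp [h0, incChain_succ_iff]
  | succ i ihi =>
    induction j with
    | zero =>
      cases k with
      | zero => simp [incChain_zero]
      | succ k => simp [h0', incChain_succ_iff]
    | succ j ihj =>
      cases k with
      | zero => simp [incChain_zero]
      | succ k =>
        by_cases hij : F i j
        · rw [(hF i j (by omega)).1 hij, Nat.succ_le_succ_iff, ihi (by omega), incChain_succ_iff]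
          constructor
          · intro h; exact ⟨i, j, hij, by omega, by omega, h⟩
          · rintro ⟨a, b, -, ha, hb, h⟩
            exact h.mono (by omega) (by omega) fun _ _ _ _ h => h
        · rw [(hF i j (by omega)).2 hij, le_max_iff, ihi hj, ihj (by omega), incChain_succ_iff,
            incChain_succ_iff, incChain_succ_iff]
          constructor
          · rintro (⟨a, b, hab, ha, hb, h⟩ | ⟨a, b, hab, ha, hb, h⟩) <;>
              exact ⟨a, b, hab, by omega, by omega, h⟩
          · rintro ⟨a, b, hab, ha, hb, h⟩
            by_cases e : b = j
            · subst e
              refine Or.inr ⟨a, b, hab, ?_, hb, h⟩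
              exact lt_of_le_of_ne (by omega) (fun e => hij (e ▸ hab))
            · exact Or.inl ⟨a, b, hab, ha, by omega, h⟩

theorem rowLen_bot (a : ℕ) : (⊥ : YoungDiagram).rowLen a = 0 := by
  by_contra h
  exact YoungDiagram.notMem_bot (a, 0) (YoungDiagram.mem_iff_lt_rowLen.2 (Nat.pos_of_ne_zero h))

theorem colLen_bot (b : ℕ) : (⊥ : YoungDiagram).colLen b = 0 := by
  by_contra h
  exact YoungDiagram.notMem_bot (0, b) (YoungDiagram.mem_iff_lt_colLen.2 (Nat.pos_of_ne_zero h))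

theorem le_rowLen_growth_iff {F : ℕ → ℕ → Prop} (hF : IsPartialPerm F) {i j k : ℕ} :
    k ≤ (growth F i j).rowLen 0 ↔ IncChain F i j k := by
  have hg := growthOn_growth hF
  exact le_iff_incChain (h := fun i j => (growth F i j).rowLen 0)
    (by simp [hg.row_zero, rowLen_bot])
    (by simp [hg.col_zero, rowLen_bot]) (fun i j _ => (hg.rule i j trivial).rowLen_zero) le_rfl

theorem RowRule.to_colRule {x : Prop} {ν lam : YoungDiagram} (h : RowRule x ⊥ ⊥ ν lam) :
    ColRule x ⊥ ⊥ ν lam := by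
  cases h with
  | stay hx => exact .stay hx _
  | right hx h => exact .right hx h
  | new hx h hs => exact .new hx h (by rw [h.snd_eq, hs]; exact rowLen_bot 0)
  | left hx h => exact h.not_self.elim
  | join hx hne h₁ => exact h₁.not_self.elim
  | bump hx h₁ => exact h₁.not_self.elim

theorem growth_eq_bot {F : ℕ → ℕ → Prop} (hF : IsPartialPerm F) {i j a : ℕ} (hj : j ≤ a) :
    growth (fun i j => F i j ∧ a ≤ j) i j = ⊥ := by
  have hg := growthOn_growth (hF.mono (F' := fun i j => F i j ∧ a ≤ j) fun _ _ h => h.1)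
  induction j with
  | zero => exact hg.col_zero i
  | succ j ih => rw [(hg.col_eq_iff fun _ _ => trivial).2 fun b _ h => by omega, ih (by omega)]

theorem colRule_growth {F : ℕ → ℕ → Prop} (hF : IsPartialPerm F) {i j a : ℕ} (haj : a < j) :
    ColRule (F i a) (growth (fun i j => F i j ∧ a + 1 ≤ j) i j)
      (growth (fun i j => F i j ∧ a + 1 ≤ j) (i + 1) j)
      (growth (fun i j => F i j ∧ a ≤ j) i j) (growth (fun i j => F i j ∧ a ≤ j) (i + 1) j) := by
  have hg := fun a => growthOn_growth (hF.mono (F' := fun i j => F i j ∧ a ≤ j) fun _ _ h => h.1)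
  induction j, haj using Nat.le_induction generalizing i with
  | base =>
    have := (hg a).rule i a trivial
    rw [growth_eq_bot hF le_rfl, growth_eq_bot hF le_rfl] at this
    rw [growth_eq_bot hF le_rfl, growth_eq_bot hF le_rfl]
    simpa using this.to_colRule
  | succ j hj ih =>
    have hadj : ∀ i, AdjRule (growth (fun i j => F i j ∧ a + 1 ≤ j) i j)
        (growth (fun i j => F i j ∧ a ≤ j) i j) (growth (fun i j => F i j ∧ a + 1 ≤ j) i (j + 1))
        (growth (fun i j => F i j ∧ a ≤ j) i (j + 1)) →
        ColRule (F i a) (growth (fun i j => F i j ∧ a + 1 ≤ j) i (j + 1))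
          (growth (fun i j => F i j ∧ a + 1 ≤ j) (i + 1) (j + 1))
          (growth (fun i j => F i j ∧ a ≤ j) i (j + 1))
          (growth (fun i j => F i j ∧ a ≤ j) (i + 1) (j + 1)) ∧
        AdjRule (growth (fun i j => F i j ∧ a + 1 ≤ j) (i + 1) j)
          (growth (fun i j => F i j ∧ a ≤ j) (i + 1) j)
          (growth (fun i j => F i j ∧ a + 1 ≤ j) (i + 1) (j + 1))
          (growth (fun i j => F i j ∧ a ≤ j) (i + 1) (j + 1)) := by
      intro i hN
      have hA := (hg (a + 1)).rule i j trivial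
      have hB := (hg a).rule i j trivial
      simp only [show a ≤ j by omega, show a + 1 ≤ j by omega, and_true] at hA hB
      exact cube (fun h => by have := hF.1 _ _ _ h.1 h.2; omega) hA hB ih hN
    refine (hadj i ?_).1
    induction i with
    | zero => simp only [(hg _).row_zero]; exact .stay id _
    | succ i ihi => exact (hadj i ihi).2

theorem le_colLen_growth_iff {F : ℕ → ℕ → Prop} (hF : IsPartialPerm F) {i j k : ℕ} :
    k ≤ (growth F i j).colLen 0 ↔ DecChain F i j k := by
  have hg := fun a => growthOn_growth (hF.mono (F' := fun i j => F i j ∧ a ≤ j) fun _ _ h => h.1)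
  have key := le_iff_incChain (F := fun i c => F i (j - 1 - c)) (J := j) (i := i) (j := j) (k := k)
    (h := fun i c => (growth (fun i b => F i b ∧ j - c ≤ b) i j).colLen 0)
    (fun c => by rw [(hg (j - c)).row_zero, colLen_bot])
    (fun i => by rw [growth_eq_bot hF (Nat.sub_zero j).ge, colLen_bot]) (fun i c hc => by
      have := (colRule_growth hF (i := i) (a := j - 1 - c) (j := j) (by omega)).colLen_zero
      rw [show j - 1 - c + 1 = j - c by omega] at this
      rwa [show j - (c + 1) = j - 1 - c by omega])
    le_rfl
  simp only [Nat.sub_self, Nat.zero_le, and_true] at key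
  rw [key]
  constructor
  · rintro ⟨r, c, hr, hc, h⟩
    refine ⟨r, fun t => j - 1 - c t, hr, fun s t hst => ?_, fun t => ⟨(h t).1, (h t).2.1, ?_⟩⟩
    · have := hc hst; have := (h t).2.2; simp only; omega
    · have := (h t).2.2; simp only; omega
  · rintro ⟨r, c, hr, hc, h⟩
    refine ⟨r, fun t => j - 1 - c t, hr, fun s t hst => ?_, fun t => ⟨?_, (h t).2.1, ?_⟩⟩
    · have := hc hst; have := (h s).2.2; simp only; omega
    · have := (h t).2.2
      simp only [show j - 1 - (j - 1 - c t) = c t by omega]; exact (h t).1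
    · have := (h t).2.2; simp only; omega

/-- The fillings `F` and `F'` of `G` have transposed growth diagram labels along the border. -/
structure Conjugate (G : Finset (ℕ × ℕ)) (F F' : ℕ → ℕ → Prop) : Prop where
  perm : IsPartialPerm F
  perm' : IsPartialPerm F'
  supp : ∀ i j, F i j → (i, j) ∈ G
  supp' : ∀ i j, F' i j → (i, j) ∈ G
  border : ∀ i j, (i, j) ∈ G → (i + 1, j + 1) ∉ G →
    growth F' (i + 1) (j + 1) = (growth F (i + 1) (j + 1)).transpose

theorem bot_transpose : (⊥ : YoungDiagram).transpose = ⊥ := by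
  apply SetLike.ext
  simp [YoungDiagram.mem_transpose]

theorem growth_swap {F : ℕ → ℕ → Prop} (hF : IsPartialPerm F) (i j : ℕ) :
    growth (fun i j => F j i) i j = growth F j i :=
  (growthOn_growth hF.swap).unique (growthOn_growth hF).swap fun _ _ _ _ => trivial

theorem Conjugate.exists {G : Finset (ℕ × ℕ)} (hG : IsLowerSet (G : Set (ℕ × ℕ)))
    {F : ℕ → ℕ → Prop} (hF : IsPartialPerm F) (hFG : ∀ i j, F i j → (i, j) ∈ G) :
    ∃ F', Conjugate G F F' := by
  have hg := growthOn_growth hF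
  obtain ⟨F', g, hF', hFG', hg', hgL⟩ := exists_growthOn G hG (fun i j => (growth F i j).transpose)
    (fun j => by rw [hg.row_zero, bot_transpose]) (fun i => by rw [hg.col_zero, bot_transpose])
    (fun i j _ _ => (hg.step_row fun _ _ => trivial).transpose)
    (fun i j _ _ => (hg.step_col fun _ _ => trivial).transpose)
  refine ⟨F', hF, hF', hFG, hFG', fun i j h h' => ?_⟩
  rw [← hgL _ _ h']
  refine ((growthOn_growth hF').mono (Set.subset_univ _)).unique hg' fun a b ha hb => ?_
  exact hG (Prod.mk_le_mk.2 ⟨by omega, by omega⟩) h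

namespace Conjugate
variable {G : Finset (ℕ × ℕ)} {F F' F'' : ℕ → ℕ → Prop}

theorem symm (h : Conjugate G F F') : Conjugate G F' F :=
  ⟨h.perm', h.perm, h.supp', h.supp, fun i j a b => by
    rw [h.border i j a b, YoungDiagram.transpose_transpose]⟩

theorem unique (hG : IsLowerSet (G : Set (ℕ × ℕ))) (h : Conjugate G F F')
    (h' : Conjugate G F F'') {i j : ℕ} : F' i j ↔ F'' i j := by
  by_cases hij : (i, j) ∈ G
  · refine (GrowthOn.eq_of_border G hG ((growthOn_growth h.perm').mono (Set.subset_univ _))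
      ((growthOn_growth h'.perm').mono (Set.subset_univ _)) (fun a b hab hab' => ?_) hij).2
    rw [h.border a b hab hab', h'.border a b hab hab']
  · exact ⟨fun hh => absurd (h.supp' _ _ hh) hij, fun hh => absurd (h'.supp' _ _ hh) hij⟩

theorem swap (hG : ∀ i j, (i, j) ∈ G → (j, i) ∈ G) (h : Conjugate G F F') :
    Conjugate G (fun i j => F j i) (fun i j => F' j i) :=
  ⟨h.perm.swap, h.perm'.swap, fun i j a => hG _ _ (h.supp _ _ a),
    fun i j a => hG _ _ (h.supp' _ _ a), fun i j a b => by
      rw [growth_swap h.perm', growth_swap h.perm]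
      exact h.border _ _ (hG _ _ a) fun hh => b (hG _ _ hh)⟩

theorem row_nonempty (hG : IsLowerSet (G : Set (ℕ × ℕ))) (h : Conjugate G F F') {i : ℕ} :
    (∃ j, F i j) → ∃ j, F' i j := by
  rintro ⟨j, hij⟩
  by_contra hne
  push Not at hne
  have hm := h.supp _ _ hij
  obtain ⟨⟨i', b⟩, hmax⟩ := (G.filter fun p => p.1 = i).exists_maximal ⟨(i, j), by simpa using hm⟩
  obtain ⟨hb, rfl⟩ := Finset.mem_filter.1 hmax.prop
  simp only at hne hij hm hb
  have hb' : (i', b + 1) ∉ G := fun hh => by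
    have := hmax.le_of_ge (Finset.mem_filter.2 ⟨hh, rfl⟩) (Prod.mk_le_mk.2 ⟨le_rfl, by omega⟩)
    simp at this
  have e1 := h.border i' b hb fun hh => hb' (hG (Prod.mk_le_mk.2 ⟨by omega, le_rfl⟩) hh)
  have e2 : growth F' i' (b + 1) = (growth F i' (b + 1)).transpose := by
    cases i' with
    | zero => rw [(growthOn_growth h.perm').row_zero, (growthOn_growth h.perm).row_zero,
        bot_transpose]
    | succ a => exact h.border a b (hG (Prod.mk_le_mk.2 ⟨by omega, le_rfl⟩) hb) hb'
  rw [((growthOn_growth h.perm').row_eq_iff fun _ _ => trivial).2 fun b _ => hne b, e2,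
    YoungDiagram.transpose_eq_iff, eq_comm,
    (growthOn_growth h.perm).row_eq_iff fun _ _ => trivial] at e1
  refine e1 j ?_ hij
  by_contra hlt
  exact hb' (hG (Prod.mk_le_mk.2 ⟨le_rfl, by omega⟩) hm)

theorem exists_border {i j : ℕ} (h : (i, j) ∈ G) :
    ∃ a b, i ≤ a ∧ j ≤ b ∧ (a, b) ∈ G ∧ (a + 1, b + 1) ∉ G := by
  obtain ⟨⟨a, b⟩, hab, hmax⟩ := G.exists_le_maximal h
  refine ⟨a, b, (Prod.mk_le_mk.1 hab).1, (Prod.mk_le_mk.1 hab).2, hmax.prop, fun hh => ?_⟩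
  have := hmax.le_of_ge hh (Prod.mk_le_mk.2 ⟨by omega, by omega⟩)
  simp at this

theorem incChain_iff (h : Conjugate G F F') {k : ℕ} :
    (∃ i j, (i, j) ∈ G ∧ IncChain F (i + 1) (j + 1) k) ↔
      ∃ i j, (i, j) ∈ G ∧ DecChain F' (i + 1) (j + 1) k := by
  constructor
  · rintro ⟨i, j, hij, hc⟩
    obtain ⟨a, b, ha, hb, hab, hab'⟩ := exists_border hij
    refine ⟨a, b, hab, ?_⟩
    rw [← le_colLen_growth_iff h.perm', h.border a b hab hab', YoungDiagram.colLen_transpose,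
      le_rowLen_growth_iff h.perm]
    exact hc.mono (by omega) (by omega) fun _ _ _ _ h => h
  · rintro ⟨i, j, hij, hc⟩
    obtain ⟨a, b, ha, hb, hab, hab'⟩ := exists_border hij
    refine ⟨a, b, hab, ?_⟩
    rw [← le_rowLen_growth_iff h.perm, h.symm.border a b hab hab', YoungDiagram.rowLen_transpose,
      le_colLen_growth_iff h.perm']
    exact hc.mono (by omega) (by omega) fun _ _ _ _ h => h

end Conjugate

theorem castAdd_lt_natAdd {a b : ℕ} (i : Fin a) (j : Fin b) : Fin.castAdd b i < Fin.natAdd a j := by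
  rw [Fin.lt_def, Fin.val_castAdd, Fin.val_natAdd]
  omega

section blockDiag
variable {a b : ℕ} (A : Matrix (Fin a) (Fin a) ℤ) (B : Matrix (Fin b) (Fin b) ℤ)

@[simp] theorem blockDiag2_castAdd_castAdd (i j : Fin a) :
    blockDiag2 A B (Fin.castAdd b i) (Fin.castAdd b j) = A i j := by simp [blockDiag2]

@[simp] theorem blockDiag2_castAdd_natAdd (i : Fin a) (j : Fin b) :
    blockDiag2 A B (Fin.castAdd b i) (Fin.natAdd a j) = 0 := by simp [blockDiag2]

@[simp] theorem blockDiag2_natAdd_castAdd (i : Fin b) (j : Fin a) :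
    blockDiag2 A B (Fin.natAdd a i) (Fin.castAdd b j) = 0 := by simp [blockDiag2]

@[simp] theorem blockDiag2_natAdd_natAdd (i j : Fin b) :
    blockDiag2 A B (Fin.natAdd a i) (Fin.natAdd a j) = B i j := by simp [blockDiag2]

end blockDiag

namespace IsSignedPermMatrix
variable {n : ℕ} {M : Matrix (Fin n) (Fin n) ℤ}

theorem row_unique (hM : IsSignedPermMatrix M) {i j j' : Fin n} (h : M i j ≠ 0) (h' : M i j' ≠ 0) :
    j = j' := (hM.2.1 i).unique h h'

theorem col_unique (hM : IsSignedPermMatrix M) {i i' j : Fin n} (h : M i j ≠ 0) (h' : M i' j ≠ 0) :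
    i = i' := (hM.2.2 j).unique h h'

end IsSignedPermMatrix

/-- `χ` occurs in `M` within the rows after `i` and the columns after `j`. -/
def Occurs {n m : ℕ} (M : Matrix (Fin n) (Fin n) ℤ) (χ : Matrix (Fin m) (Fin m) ℤ) (i j : ℕ) :
    Prop :=
  ∃ r c : Fin m → Fin n, StrictMono r ∧ StrictMono c ∧ (∀ t, i < r t) ∧ (∀ t, j < c t) ∧
    ∀ a b, M (r a) (c b) = χ a b

open Classical in
/-- The cells with an occurrence of `χ` strictly below and to the right, up to reflection. -/
noncomputable def shadow {n m : ℕ} (M : Matrix (Fin n) (Fin n) ℤ) (χ : Matrix (Fin m) (Fin m) ℤ) :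
    Finset (ℕ × ℕ) :=
  (Finset.range n ×ˢ Finset.range n).filter fun p => Occurs M χ p.1 p.2 ∨ Occurs M χ p.2 p.1

/-- The cells of `G` in which `M` has the entry `1`. -/
def Marks {n : ℕ} (M : Matrix (Fin n) (Fin n) ℤ) (G : Finset (ℕ × ℕ)) (i j : ℕ) : Prop :=
  (i, j) ∈ G ∧ ∃ (hi : i < n) (hj : j < n), M ⟨i, hi⟩ ⟨j, hj⟩ = 1

section shadow
variable {n m : ℕ} {M M' : Matrix (Fin n) (Fin n) ℤ} {χ : Matrix (Fin m) (Fin m) ℤ}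
  {G : Finset (ℕ × ℕ)}

theorem Occurs.mono {i j i' j' : ℕ} (h : Occurs M χ i j) (hi : i' ≤ i) (hj : j' ≤ j) :
    Occurs M χ i' j' := by
  obtain ⟨r, c, hr, hc, h1, h2, h⟩ := h
  exact ⟨r, c, hr, hc, fun t => hi.trans_lt (h1 t), fun t => hj.trans_lt (h2 t), h⟩

theorem mem_shadow {i j : ℕ} :
    (i, j) ∈ shadow M χ ↔ (i < n ∧ j < n) ∧ (Occurs M χ i j ∨ Occurs M χ j i) := by
  simp [shadow]

theorem shadow_symm {i j : ℕ} (h : (i, j) ∈ shadow M χ) : (j, i) ∈ shadow M χ := by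
  rw [mem_shadow] at h ⊢; tauto

theorem isLowerSet_shadow : IsLowerSet (shadow M χ : Set (ℕ × ℕ)) := by
  rintro ⟨i, j⟩ ⟨i', j'⟩ hle h
  obtain ⟨hi, hj⟩ := Prod.mk_le_mk.1 hle
  rw [Finset.mem_coe, mem_shadow] at h ⊢
  exact ⟨⟨by omega, by omega⟩, h.2.imp (·.mono hi hj) (·.mono hj hi)⟩

theorem shadow_subset (h : ∀ a b : Fin n, ((a : ℕ), (b : ℕ)) ∉ shadow M χ → M a b = M' a b) :
    shadow M χ ⊆ shadow M' χ := by
  have key : ∀ i j : ℕ, (∀ a b, i < a → j < b → (a, b) ∉ shadow M χ) → Occurs M χ i j →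
      Occurs M' χ i j := by
    rintro i j hij ⟨r, c, hr, hc, h1, h2, h3⟩
    exact ⟨r, c, hr, hc, h1, h2, fun a b => by rw [← h _ _ (hij _ _ (h1 a) (h2 b)), h3]⟩
  rintro ⟨i, j⟩ hij
  obtain ⟨⟨a, b⟩, hab, hmax⟩ := (shadow M χ).exists_le_maximal hij
  have hm : ∀ a' b', a < a' → b < b' → (a', b') ∉ shadow M χ := fun a' b' ha hb hh => by
    have := hmax.le_of_ge hh (Prod.mk_le_mk.2 ⟨ha.le, hb.le⟩)
    exact ha.not_ge (Prod.mk_le_mk.1 this).1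
  refine isLowerSet_shadow hab (Finset.mem_coe.2 ?_)
  have := mem_shadow.1 hmax.prop
  exact mem_shadow.2 ⟨this.1, this.2.imp (key _ _ hm)
    (key _ _ fun a' b' ha hb hh => hm _ _ hb ha (shadow_symm hh))⟩

theorem Marks.apply_eq {i j : Fin n} (h : Marks M G i j) : M i j = 1 := h.2.2.2

theorem marks_iff {i j : Fin n} : Marks M G i j ↔ ((i : ℕ), (j : ℕ)) ∈ G ∧ M i j = 1 := by
  simp [Marks]

theorem isPartialPerm_marks (hM : IsSignedPermMatrix M) : IsPartialPerm (Marks M G) := by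
  refine ⟨?_, ?_⟩
  · rintro i j j' ⟨-, hi, hj, h⟩ ⟨-, _, hj', h'⟩
    have := hM.row_unique (j := ⟨j, hj⟩) (j' := ⟨j', hj'⟩) (h ▸ one_ne_zero) (h' ▸ one_ne_zero)
    simpa using this
  · rintro i i' j ⟨-, hi, hj, h⟩ ⟨-, hi', _, h'⟩
    have := hM.col_unique (i := ⟨i, hi⟩) (i' := ⟨i', hi'⟩) (h ▸ one_ne_zero) (h' ▸ one_ne_zero)
    simpa using this

theorem Marks.swap (hs : M.IsSymm) {i j : ℕ} (h : Marks M (shadow M χ) i j) :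
    Marks M (shadow M χ) j i := by
  obtain ⟨h, hi, hj, e⟩ := h
  exact ⟨shadow_symm h, hj, hi, by rw [hs.apply, e]⟩

theorem containsPattern_blockDiag2_iff {k : ℕ} {A : Matrix (Fin (k + 1)) (Fin (k + 1)) ℤ}
    {e : Fin (k + 1) → Fin (k + 1)} (he : Function.Involutive e)
    (hA : ∀ a b, A a b = if b = e a then 1 else 0) (hM : IsSignedPermMatrix M) (hs : M.IsSymm) :
    ContainsPattern M (blockDiag2 A χ) ↔ ∃ i j, (i, j) ∈ shadow M χ ∧
      ∃ r c : Fin (k + 1) → ℕ, StrictMono r ∧ StrictMono c ∧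
        ∀ t, Marks M (shadow M χ) (r t) (c (e t)) ∧ r t < i + 1 ∧ c t < j + 1 := by
  constructor
  · rintro ⟨r, c, hr, hc, h⟩
    have hlast : ∀ t, Fin.castAdd m t ≤ Fin.castAdd m (Fin.last k) := fun t =>
      (Fin.strictMono_castAdd m).monotone (Fin.le_last t)
    have hocc : Occurs M χ (r (Fin.castAdd m (Fin.last k))) (c (Fin.castAdd m (Fin.last k))) :=
      ⟨r ∘ Fin.natAdd _, c ∘ Fin.natAdd _, hr.comp (Fin.strictMono_natAdd _),
        hc.comp (Fin.strictMono_natAdd _), fun t => hr (castAdd_lt_natAdd _ _),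
        fun t => hc (castAdd_lt_natAdd _ _), fun a b => by simp [h]⟩
    refine ⟨_, _, mem_shadow.2 ⟨⟨Fin.is_lt _, Fin.is_lt _⟩, Or.inl hocc⟩,
      fun t => r (Fin.castAdd m t), fun t => c (Fin.castAdd m t),
      fun s t hst => hr (Fin.strictMono_castAdd m hst),
      fun s t hst => hc (Fin.strictMono_castAdd m hst), fun t => ⟨marks_iff.2 ⟨?_, ?_⟩,
        Nat.lt_succ_of_le (hr.monotone (hlast t)), Nat.lt_succ_of_le (hc.monotone (hlast t))⟩⟩
    · exact mem_shadow.2 ⟨⟨Fin.is_lt _, Fin.is_lt _⟩,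
        Or.inl (hocc.mono (hr.monotone (hlast _)) (hc.monotone (hlast _)))⟩
    · simp [h, hA]
  · have key : ∀ i j, Occurs M χ i j → (∃ r c : Fin (k + 1) → ℕ, StrictMono r ∧ StrictMono c ∧
        ∀ t, Marks M (shadow M χ) (r t) (c (e t)) ∧ r t < i + 1 ∧ c t < j + 1) →
        ContainsPattern M (blockDiag2 A χ) := by
      rintro i j ⟨r', c', hr', hc', hi, hj, hχ⟩ ⟨r, c, hr, hc, h⟩
      have hrn : ∀ t, r t < n := fun t => (h t).1.2.1
      have hcn : ∀ t, c t < n := fun t => by simpa [he t] using (h (e t)).1.2.2.1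
      have hmono : ∀ (r : Fin (k + 1) → ℕ) (hrn : ∀ t, r t < n) (r' : Fin m → Fin n) (i : ℕ),
          StrictMono r → StrictMono r' → (∀ t, r t < i + 1) → (∀ t, i < r' t) →
          StrictMono (Fin.addCases (motive := fun _ => Fin n) (fun t => ⟨r t, hrn t⟩) r') := by
        intro r hrn r' i hr hr' hi hi' s t
        induction s using Fin.addCases with
        | left s =>
          induction t using Fin.addCases with
          | left t =>
            intro hst
            simp only [Fin.addCases_left]
            exact hr ((Fin.strictMono_castAdd m).lt_iff_lt.1 hst)
          | right t =>
            intro _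
            have := hi s; have := hi' t
            simp only [Fin.addCases_left, Fin.addCases_right, Fin.lt_def]
            omega
        | right s =>
          induction t using Fin.addCases with
          | left t => intro hst; exact absurd hst (castAdd_lt_natAdd _ _).not_gt
          | right t => simpa using fun hst => hr' hst
      have hone : ∀ t, M ⟨r t, hrn t⟩ ⟨c (e t), hcn (e t)⟩ = 1 := fun t => (h t).1.2.2.2
      refine ⟨_, _, hmono r hrn r' i hr hr' (fun t => (h t).2.1) hi,
        hmono c hcn c' j hc hc' (fun t => (h t).2.2) hj, fun a b => ?_⟩
      induction a using Fin.addCases with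
      | left a =>
        induction b using Fin.addCases with
        | left b =>
          simp only [Fin.addCases_left, blockDiag2_castAdd_castAdd, hA]
          split_ifs with hb
          · subst hb; exact hone a
          · by_contra hne
            have := hM.row_unique hne (j' := ⟨c (e a), hcn (e a)⟩) (by rw [hone]; simp)
            exact hb (hc.injective (by simpa using this))
        | right b =>
          simp only [Fin.addCases_left, Fin.addCases_right, blockDiag2_castAdd_natAdd]
          by_contra hne
          have := hM.row_unique hne (j' := ⟨c (e a), hcn (e a)⟩) (by rw [hone]; simp)
          have := congrArg Fin.val this
          have := hj b; have := (h (e a)).2.2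
          simp only at *
          omega
      | right a =>
        induction b using Fin.addCases with
        | left b =>
          simp only [Fin.addCases_left, Fin.addCases_right, blockDiag2_natAdd_castAdd]
          by_contra hne
          have := hM.col_unique hne (i' := ⟨r (e b), hrn (e b)⟩) (by
            have := hone (e b); simp only [he b] at this; rw [this]; simp)
          have := congrArg Fin.val this
          have := hi a; have := (h (e b)).2.1
          simp only at *
          omega
        | right b => simpa using hχ a b
    rintro ⟨i, j, hij, r, c, hr, hc, h⟩
    rcases (mem_shadow.1 hij).2 with ho | ho
    · exact key i j ho ⟨r, c, hr, hc, h⟩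
    · refine key j i ho ⟨c, r, hc, hr, fun t => ⟨?_, (h t).2.symm⟩⟩
      simpa [he t] using (h (e t)).1.swap hs

end shadow

/-- `M'` arises from `M` by conjugating the filling by ones of the shadow of `χ`. -/
structure Twin {n m : ℕ} (χ : Matrix (Fin m) (Fin m) ℤ) (M M' : Matrix (Fin n) (Fin n) ℤ) :
    Prop where
  signed : IsSignedPermMatrix M
  signed' : IsSignedPermMatrix M'
  symmetric : M.IsSymm
  symmetric' : M'.IsSymm
  shadow_eq : shadow M χ = shadow M' χ
  conj : Conjugate (shadow M χ) (Marks M (shadow M χ)) (Marks M' (shadow M' χ))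
  agree : ∀ a b : Fin n, M a b = M' a b ∨ Marks M (shadow M χ) a b ∨ Marks M' (shadow M' χ) a b

namespace Twin
variable {n m : ℕ} {χ : Matrix (Fin m) (Fin m) ℤ} {M M' M'' : Matrix (Fin n) (Fin n) ℤ}

theorem symm (h : Twin χ M M') : Twin χ M' M :=
  ⟨h.signed', h.signed, h.symmetric', h.symmetric, h.shadow_eq.symm,
    h.shadow_eq ▸ h.conj.symm, fun a b => (h.agree a b).imp Eq.symm Or.symm⟩

theorem unique (h : Twin χ M M') (h' : Twin χ M M'') : M' = M'' := by
  ext a b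
  have hiff : ∀ {a b}, Marks M' (shadow M' χ) a b ↔ Marks M'' (shadow M'' χ) a b :=
    h.conj.unique isLowerSet_shadow h'.conj
  by_cases h1 : Marks M' (shadow M' χ) a b
  · rw [h1.apply_eq, (hiff.1 h1).apply_eq]
  by_cases h2 : Marks M (shadow M χ) a b
  · have zero : ∀ {N}, Twin χ M N → ¬ Marks N (shadow N χ) a b → N a b = 0 := by
      intro N hN h1
      obtain ⟨j, hj⟩ := hN.conj.row_nonempty isLowerSet_shadow ⟨_, h2⟩
      obtain ⟨-, _, hjn, e⟩ := id hj
      by_contra hne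
      obtain rfl := hN.signed'.row_unique hne (j' := ⟨j, hjn⟩) (e ▸ one_ne_zero)
      exact h1 hj
    rw [zero h h1, zero h' (hiff.not.1 h1)]
  · rw [← ((h.agree a b).resolve_right (by tauto)),
      ← ((h'.agree a b).resolve_right (by rw [← hiff]; tauto))]

theorem exists_twin (hM : IsSignedPermMatrix M) (hs : M.IsSymm) : ∃ M', Twin χ M M' := by
  classical
  obtain ⟨F, hF⟩ := Conjugate.exists isLowerSet_shadow (isPartialPerm_marks (G := shadow M χ) hM)
    fun i j h => h.1
  have hswap : ∀ i j, F i j ↔ F j i := by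
    intro i j
    have h1 := hF.swap fun _ _ => shadow_symm
    have h2 : (fun i j => Marks M (shadow M χ) j i) = Marks M (shadow M χ) := by
      funext i j
      exact propext ⟨fun h => h.swap hs, fun h => h.swap hs⟩
    rw [h2] at h1
    exact hF.unique isLowerSet_shadow h1
  have hFn : ∀ {i j}, F i j → j < n := fun h => (mem_shadow.1 (hF.supp' _ _ h)).1.2
  let M' : Matrix (Fin n) (Fin n) ℤ := fun a b =>
    if F a b then 1 else if Marks M (shadow M χ) a b then 0 else M a b
  have hpos : ∀ {a b : Fin n}, F a b → M' a b = 1 := fun h => if_pos h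
  have hneg : ∀ {a b : Fin n}, ¬ F a b → Marks M (shadow M χ) a b → M' a b = 0 := fun h h' => by
    simp [M', h, h']
  have hout : ∀ {a b : Fin n}, ¬ F a b → ¬ Marks M (shadow M χ) a b → M' a b = M a b :=
    fun h h' => by simp [M', h, h']
  have hs' : M'.IsSymm := by
    ext a b
    have : Marks M (shadow M χ) a b ↔ Marks M (shadow M χ) b a :=
      ⟨fun h => h.swap hs, fun h => h.swap hs⟩
    change M' b a = M' a b
    simp only [M', hswap b a, this, hs.apply a b]
  have hrow : ∀ a, ∃! b, M' a b ≠ 0 := by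
    intro a
    by_cases hne : ∃ j, F a j
    · obtain ⟨j, hj⟩ := hne
      obtain ⟨j', hj'⟩ := hF.symm.row_nonempty isLowerSet_shadow ⟨j, hj⟩
      obtain ⟨-, _, hjn, e⟩ := id hj'
      refine ⟨⟨j, hFn hj⟩, by simp [hpos (a := a) (b := ⟨j, hFn hj⟩) hj], fun b hb => ?_⟩
      have : F a b := by
        by_contra h1
        by_cases h2 : Marks M (shadow M χ) a b
        · exact hb (hneg h1 h2)
        · simp only [hout h1 h2] at hb
          obtain rfl := hM.row_unique hb (j' := ⟨j', hjn⟩) (e ▸ one_ne_zero)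
          exact h2 hj'
      exact Fin.ext (hF.perm'.1 _ _ _ this hj)
    · have h1 : ∀ b : Fin n, ¬ F a b := fun b h => hne ⟨b, h⟩
      have h2 : ∀ b : Fin n, ¬ Marks M (shadow M χ) a b := fun b h =>
        hne (hF.row_nonempty isLowerSet_shadow ⟨b, h⟩)
      simpa only [hout (h1 _) (h2 _)] using hM.2.1 a
  have hM' : IsSignedPermMatrix M' := by
    refine ⟨fun a b => ?_, hrow, fun b => ?_⟩
    · have := hM.1 a b
      simp only [M']
      split_ifs <;> simp [this]
    · simpa only [hs'.apply] using hrow b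
  have hag : ∀ a b : Fin n, ((a : ℕ), (b : ℕ)) ∉ shadow M χ → M a b = M' a b := fun a b h =>
    (hout (fun h' => h (hF.supp' _ _ h')) fun h' => h h'.1).symm
  have hsh : shadow M χ = shadow M' χ := by
    have h1 := shadow_subset hag
    exact h1.antisymm (shadow_subset fun a b h => (hag a b fun h' => h (h1 h')).symm)
  have hmarks : Marks M' (shadow M' χ) = F := by
    funext i j
    refine propext ⟨?_, fun h => ?_⟩
    · rintro ⟨h, hi, hj, e⟩
      by_contra h1
      by_cases h2 : Marks M (shadow M χ) i j
      · simp [hneg (a := ⟨i, hi⟩) (b := ⟨j, hj⟩) h1 h2] at e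
      · rw [hout (a := ⟨i, hi⟩) (b := ⟨j, hj⟩) h1 h2] at e
        exact h2 ⟨hsh ▸ h, hi, hj, e⟩
    · exact ⟨hsh ▸ hF.supp' _ _ h, hFn ((hswap _ _).1 h), hFn h,
        hpos (a := ⟨i, _⟩) (b := ⟨j, _⟩) h⟩
  refine ⟨M', hM, hM', hs, hs', hsh, hmarks ▸ hF, fun a b => ?_⟩
  rw [hmarks]
  by_cases h1 : F a b
  · exact Or.inr (Or.inr h1)
  · by_cases h2 : Marks M (shadow M χ) a b
    · exact Or.inr (Or.inl h2)
    · exact Or.inl (hout h1 h2).symm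

theorem containsPattern_iff (h : Twin χ M M') (k : ℕ) :
    ContainsPattern M (blockDiag2 (1 : Matrix (Fin (k + 1)) (Fin (k + 1)) ℤ) χ) ↔
      ContainsPattern M' (blockDiag2 (betaMat (k + 1)) χ) := by
  have hβ : ∀ a b, betaMat (k + 1) a b = if b = Fin.rev a then 1 else 0 := by
    intro a b
    simp only [betaMat, of_apply, Fin.ext_iff, Fin.val_rev]
    congr 1
    have := a.is_lt
    exact propext ⟨fun h => by omega, fun h => by omega⟩
  rw [containsPattern_blockDiag2_iff (e := id) (fun _ => rfl)
      (fun a b => by simp [one_apply, eq_comm]) h.signed h.symmetric,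
    containsPattern_blockDiag2_iff Fin.rev_involutive hβ h.signed' h.symmetric']
  have key := h.conj.incChain_iff (k := k + 1)
  rw [h.shadow_eq] at key ⊢
  refine key.trans (exists_congr fun i => exists_congr fun j => and_congr_right fun _ => ?_)
  constructor
  · rintro ⟨r, c, hr, hc, hh⟩
    exact ⟨r, c ∘ Fin.rev, hr, hc.comp Fin.rev_strictAnti, fun t =>
      ⟨by simpa using (hh t).1, (hh t).2.1, (hh _).2.2⟩⟩
  · rintro ⟨r, c, hr, hc, hh⟩
    exact ⟨r, c ∘ Fin.rev, hr, hc.comp_strictAnti Fin.rev_strictAnti, fun t =>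
      ⟨(hh t).1, (hh t).2.1, (hh _).2.2⟩⟩

end Twin

theorem siAvoidCount_one_eq_beta {m : ℕ} (χ : Matrix (Fin m) (Fin m) ℤ) (k n : ℕ) :
    SIAvoidCount n (blockDiag2 (1 : Matrix (Fin k) (Fin k) ℤ) χ) =
      SIAvoidCount n (blockDiag2 (betaMat k) χ) := by
  obtain _ | k := k
  · rw [Subsingleton.elim (1 : Matrix (Fin 0) (Fin 0) ℤ) (betaMat 0)]
  have hex : ∀ M : Matrix (Fin n) (Fin n) ℤ, IsSignedPermMatrix M → M.IsSymm → ∃ M', Twin χ M M' :=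
    fun M => Twin.exists_twin
  choose f hf using hex
  refine Set.ncard_congr (fun M hM => f M hM.1 hM.2.1) ?_ ?_ ?_
  · intro M hM
    have h := hf M hM.1 hM.2.1
    exact ⟨h.signed', h.symmetric', fun hc => hM.2.2 ((h.containsPattern_iff k).2 hc)⟩
  · intro M N hM hN e
    have h := (hf M hM.1 hM.2.1).symm
    rw [e] at h
    exact h.unique (hf N hN.1 hN.2.1).symm
  · intro N hN
    have h := (hf N hN.1 hN.2.1).symm
    refine ⟨f N hN.1 hN.2.1, ⟨h.signed, h.symmetric, fun hc => ?_⟩, ?_⟩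
    · exact hN.2.2 ((h.containsPattern_iff k).1 hc)
    · exact (hf _ h.signed h.symmetric).unique h

section transport
variable {n a b c : ℕ} {M : Matrix (Fin n) (Fin n) ℤ}

/-- Rotation of a square matrix by a half turn. -/
def rotate (M : Matrix (Fin n) (Fin n) ℤ) : Matrix (Fin n) (Fin n) ℤ := M.submatrix Fin.rev Fin.rev

theorem rotate_rotate (M : Matrix (Fin n) (Fin n) ℤ) : rotate (rotate M) = M := by
  ext; simp [rotate]

theorem IsSignedPermMatrix.rotate (hM : IsSignedPermMatrix M) : IsSignedPermMatrix (rotate M) := by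
  refine ⟨fun i j => hM.1 _ _, fun i => ?_, fun j => ?_⟩
  · obtain ⟨j, hj, hu⟩ := hM.2.1 i.rev
    exact ⟨j.rev, by simpa [_root_.rotate] using hj, fun j' h => by rw [← hu _ h, Fin.rev_rev]⟩
  · obtain ⟨i, hi, hu⟩ := hM.2.2 j.rev
    exact ⟨i.rev, by simpa [_root_.rotate] using hi, fun i' h => by rw [← hu _ h, Fin.rev_rev]⟩

theorem ContainsPattern.rotate {τ : Matrix (Fin a) (Fin a) ℤ} (h : ContainsPattern M τ) :
    ContainsPattern (rotate M) (rotate τ) := by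
  obtain ⟨r, c, hr, hc, h⟩ := h
  have key : ∀ r : Fin a → Fin n, StrictMono r → StrictMono (Fin.rev ∘ r ∘ Fin.rev) :=
    fun r hr => Fin.rev_strictAnti.comp (hr.comp_strictAnti Fin.rev_strictAnti)
  exact ⟨_, _, key r hr, key c hc, fun i j => by simp [_root_.rotate, h]⟩

theorem siAvoidCount_rotate (n : ℕ) (τ : Matrix (Fin a) (Fin a) ℤ) :
    SIAvoidCount n (rotate τ) = SIAvoidCount n τ := by
  have hs : ∀ M : Matrix (Fin n) (Fin n) ℤ, M.IsSymm → (rotate M).IsSymm := fun M h => by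
    ext i j; exact h.apply _ _
  refine Set.ncard_congr (fun M _ => rotate M) ?_ ?_ ?_
  · rintro M ⟨h1, h2, h3⟩
    exact ⟨h1.rotate, hs M h2, fun h => h3 (by simpa only [rotate_rotate] using h.rotate)⟩
  · intro M N _ _ e
    simpa only [rotate_rotate] using congrArg rotate e
  · rintro M ⟨h1, h2, h3⟩
    refine ⟨rotate M, ⟨h1.rotate, hs M h2, fun h => h3 ?_⟩, rotate_rotate M⟩
    simpa only [rotate_rotate] using h.rotate

theorem siAvoidCount_congr (n : ℕ) {τ : Matrix (Fin a) (Fin a) ℤ} {σ : Matrix (Fin b) (Fin b) ℤ}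
    (h : a = b) (hτ : ∀ i j, τ i j = σ (Fin.cast h i) (Fin.cast h j)) :
    SIAvoidCount n τ = SIAvoidCount n σ := by
  subst h
  congr 1
  ext i j
  exact hτ i j

theorem siAvoidCount_assoc (n : ℕ) (A : Matrix (Fin a) (Fin a) ℤ) (B : Matrix (Fin b) (Fin b) ℤ)
    (C : Matrix (Fin c) (Fin c) ℤ) :
    SIAvoidCount n (blockDiag2 (blockDiag2 A B) C) =
      SIAvoidCount n (blockDiag2 A (blockDiag2 B C)) := by
  refine siAvoidCount_congr n (Nat.add_assoc a b c) fun i j => ?_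
  have e1 : ∀ i : Fin a, Fin.cast (Nat.add_assoc a b c) (Fin.castAdd c (Fin.castAdd b i)) =
      Fin.castAdd (b + c) i := fun _ => rfl
  have e2 : ∀ i : Fin b, Fin.cast (Nat.add_assoc a b c) (Fin.castAdd c (Fin.natAdd a i)) =
      Fin.natAdd a (Fin.castAdd c i) := fun _ => rfl
  have e3 : ∀ i : Fin c, Fin.cast (Nat.add_assoc a b c) (Fin.natAdd (a + b) i) =
      Fin.natAdd a (Fin.natAdd b i) := fun _ => Fin.ext (Nat.add_assoc _ _ _)
  induction i using Fin.addCases with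
  | left i =>
    induction i using Fin.addCases <;> induction j using Fin.addCases with
    | left j => induction j using Fin.addCases <;> simp [e1, e2]
    | right j => simp [e1, e2, e3]
  | right i =>
    induction j using Fin.addCases with
    | left j => induction j using Fin.addCases <;> simp [e1, e2, e3]
    | right j => simp [e3]

theorem siAvoidCount_rotate_blockDiag2 (n : ℕ) (A : Matrix (Fin a) (Fin a) ℤ)
    (B : Matrix (Fin b) (Fin b) ℤ) :
    SIAvoidCount n (blockDiag2 A B) = SIAvoidCount n (blockDiag2 (rotate B) (rotate A)) := by
  rw [← siAvoidCount_rotate]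
  refine siAvoidCount_congr n (Nat.add_comm a b) fun i j => ?_
  have e1 : ∀ i : Fin a, Fin.cast (Nat.add_comm a b) (Fin.castAdd b i).rev = Fin.natAdd b i.rev :=
    fun i => by ext; simp; omega
  have e2 : ∀ i : Fin b, Fin.cast (Nat.add_comm a b) (Fin.natAdd a i).rev = Fin.castAdd a i.rev :=
    fun i => by ext; simp; omega
  obtain ⟨i, rfl⟩ := Fin.rev_surjective i
  obtain ⟨j, rfl⟩ := Fin.rev_surjective j
  simp only [rotate, submatrix_apply, Fin.rev_rev]
  induction i using Fin.addCases <;> induction j using Fin.addCases <;> simp [e1, e2]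

theorem rotate_one : rotate (1 : Matrix (Fin n) (Fin n) ℤ) = 1 := by
  ext i j; simp [rotate, one_apply]

theorem rotate_betaMat (n : ℕ) : rotate (betaMat n) = betaMat n := by
  ext i j
  simp only [rotate, betaMat, submatrix_apply, of_apply, Fin.val_rev]
  congr 1
  exact propext (by omega)

end transport

/-- diag(α_k, χ, α_l) and diag(β_k, χ, β_l) are I-Wilf equivalent. -/
theorem stmt15 {m : ℕ} (χ : Matrix (Fin m) (Fin m) ℤ) (hχ : IsSignedPermMatrix χ)
    (k l : ℕ) :
    ∀ n : ℕ, 1 ≤ n →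
      SIAvoidCount n (blockDiag3 (1 : Matrix (Fin k) (Fin k) ℤ) χ
        (1 : Matrix (Fin l) (Fin l) ℤ)) =
      SIAvoidCount n (blockDiag3 (betaMat k) χ (betaMat l)) := by
  intro n _
  simp only [blockDiag3]
  rw [siAvoidCount_assoc, siAvoidCount_one_eq_beta, ← siAvoidCount_assoc,
    siAvoidCount_rotate_blockDiag2, rotate_one, siAvoidCount_one_eq_beta,
    siAvoidCount_rotate_blockDiag2 n (blockDiag2 (betaMat k) χ), rotate_betaMat]
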